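/- For each n ∈ ℕ, the theories WRΣ0(Σ_n), WR(Σ_{n+1} ∨ Π_{n+1}), and BΣ_{n+2} are pairwise equivalent (they have the same models, over IΔ0). -/

import Mathlib

namespace PaperArith

/-! ## Syntax of (two-sorted) first-order arithmetic

Terms and formulas of arithmetic in the language `{0, 1, +, ·, <}`,
with number variables and (monadic second-order) set variables both indexed
by natural numbers.  Bounded quantifiers are taken as primitives, so that the
class `Δ₀` of bounded formulas is a purely syntactic class. -/

/-- Terms of first-order arithmetic in the language `{0, 1, +, ·, <}`. -/
inductive Term : Type
  | var : ℕ → Term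
  | zero : Term
  | one : Term
  | add : Term → Term → Term
  | mul : Term → Term → Term

/-- Formulas of (two-sorted) arithmetic.  `mem t i` is the atomic formula
`t ∈ Xᵢ`; `ball x t φ` is `∀ x < t, φ` and `bex x t φ` is `∃ x < t, φ`;
`sall i φ` and `sex i φ` quantify over the set variable `Xᵢ`.
Purely first-order formulas are those avoiding `mem`, `sall`, `sex`. -/
inductive Fml : Type
  | eq : Term → Term → Fml
  | lt : Term → Term → Fml
  | mem : Term → ℕ → Fml
  | not : Fml → Fml
  | and : Fml → Fml → Fml
  | or : Fml → Fml → Fml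
  | imp : Fml → Fml → Fml
  | all : ℕ → Fml → Fml
  | ex : ℕ → Fml → Fml
  | ball : ℕ → Term → Fml → Fml
  | bex : ℕ → Term → Fml → Fml
  | sall : ℕ → Fml → Fml
  | sex : ℕ → Fml → Fml

/-- A structure for the first-order language of arithmetic. -/
structure Str : Type 1 where
  M : Type
  zero : M
  one : M
  add : M → M → M
  mul : M → M → M
  lt : M → M → Prop

/-- Value of a term under a valuation of the number variables. -/
def tval (S : Str) (v : ℕ → S.M) : Term → S.M
  | .var i => v i
  | .zero => S.zero
  | .one => S.one
  | .add t u => S.add (tval S v t) (tval S v u)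
  | .mul t u => S.mul (tval S v t) (tval S v u)

/-- Update a valuation at one variable. -/
def upd {α : Type} (v : ℕ → α) (x : ℕ) (a : α) : ℕ → α :=
  fun i => if i = x then a else v i

/-- Tarskian satisfaction over the structure `S`, with second-order universe
`X` (set quantifiers range over `X`); `v` is the valuation of number
variables, `w` the valuation of set variables. -/
def Sat (S : Str) (X : Set (Set S.M)) : (ℕ → S.M) → (ℕ → Set S.M) → Fml → Prop
  | v, _, .eq t u => tval S v t = tval S v u
  | v, _, .lt t u => S.lt (tval S v t) (tval S v u)
  | v, w, .mem t i => tval S v t ∈ w i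
  | v, w, .not φ => ¬ Sat S X v w φ
  | v, w, .and φ ψ => Sat S X v w φ ∧ Sat S X v w ψ
  | v, w, .or φ ψ => Sat S X v w φ ∨ Sat S X v w ψ
  | v, w, .imp φ ψ => Sat S X v w φ → Sat S X v w ψ
  | v, w, .all x φ => ∀ m : S.M, Sat S X (upd v x m) w φ
  | v, w, .ex x φ => ∃ m : S.M, Sat S X (upd v x m) w φ
  | v, w, .ball x t φ => ∀ m : S.M, S.lt m (tval S v t) → Sat S X (upd v x m) w φ
  | v, w, .bex x t φ => ∃ m : S.M, S.lt m (tval S v t) ∧ Sat S X (upd v x m) w φ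
  | v, w, .sall i φ => ∀ A : Set S.M, A ∈ X → Sat S X v (upd w i A) φ
  | v, w, .sex i φ => ∃ A : Set S.M, A ∈ X ∧ Sat S X v (upd w i A) φ

/-- First-order satisfaction (for purely first-order formulas the second-order
data is irrelevant). -/
def Sat0 (S : Str) (v : ℕ → S.M) (φ : Fml) : Prop :=
  Sat S ∅ v (fun _ => ∅) φ

/-! ## The arithmetic hierarchy -/

/-- `Δ₀` formulas: purely first-order, only bounded quantifiers. -/
inductive Delta0 : Fml → Prop
  | eq (t u : Term) : Delta0 (.eq t u)
  | lt (t u : Term) : Delta0 (.lt t u)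
  | not {φ : Fml} : Delta0 φ → Delta0 (.not φ)
  | and {φ ψ : Fml} : Delta0 φ → Delta0 ψ → Delta0 (.and φ ψ)
  | or {φ ψ : Fml} : Delta0 φ → Delta0 ψ → Delta0 (.or φ ψ)
  | imp {φ ψ : Fml} : Delta0 φ → Delta0 ψ → Delta0 (.imp φ ψ)
  | ball (x : ℕ) (t : Term) {φ : Fml} : Delta0 φ → Delta0 (.ball x t φ)
  | bex (x : ℕ) (t : Term) {φ : Fml} : Delta0 φ → Delta0 (.bex x t φ)

mutual
  /-- `Σₙ` formulas of the first-order arithmetic hierarchy. -/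
  inductive IsSigma : ℕ → Fml → Prop
    | delta0 {n : ℕ} {φ : Fml} : Delta0 φ → IsSigma n φ
    | ofPi {n : ℕ} {φ : Fml} : IsPi n φ → IsSigma (n + 1) φ
    | ex (x : ℕ) {n : ℕ} {φ : Fml} : IsSigma (n + 1) φ → IsSigma (n + 1) (.ex x φ)
  /-- `Πₙ` formulas of the first-order arithmetic hierarchy. -/
  inductive IsPi : ℕ → Fml → Prop
    | delta0 {n : ℕ} {φ : Fml} : Delta0 φ → IsPi n φ
    | ofSigma {n : ℕ} {φ : Fml} : IsSigma n φ → IsPi (n + 1) φ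
    | all (x : ℕ) {n : ℕ} {φ : Fml} : IsPi (n + 1) φ → IsPi (n + 1) (.all x φ)
end

/-- `Σ₀(Σₙ)`: the closure of `Σₙ` under Boolean operations and bounded
quantification. -/
inductive Sigma0Sigma (n : ℕ) : Fml → Prop
  | ofSigma {φ : Fml} : IsSigma n φ → Sigma0Sigma n φ
  | not {φ : Fml} : Sigma0Sigma n φ → Sigma0Sigma n (.not φ)
  | and {φ ψ : Fml} : Sigma0Sigma n φ → Sigma0Sigma n ψ → Sigma0Sigma n (.and φ ψ)
  | or {φ ψ : Fml} : Sigma0Sigma n φ → Sigma0Sigma n ψ → Sigma0Sigma n (.or φ ψ)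
  | imp {φ ψ : Fml} : Sigma0Sigma n φ → Sigma0Sigma n ψ → Sigma0Sigma n (.imp φ ψ)
  | ball (x : ℕ) (t : Term) {φ : Fml} : Sigma0Sigma n φ → Sigma0Sigma n (.ball x t φ)
  | bex (x : ℕ) (t : Term) {φ : Fml} : Sigma0Sigma n φ → Sigma0Sigma n (.bex x t φ)

/-- The class `Σₙ ∧ Πₙ` of conjunctions of a `Σₙ` and a `Πₙ` formula. -/
def SigmaAndPi (n : ℕ) (φ : Fml) : Prop :=
  ∃ ψ χ : Fml, IsSigma n ψ ∧ IsPi n χ ∧ φ = Fml.and ψ χ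

/-- The class `Σₙ ∨ Πₙ` of disjunctions of a `Σₙ` and a `Πₙ` formula. -/
def SigmaOrPi (n : ℕ) (φ : Fml) : Prop :=
  ∃ ψ χ : Fml, IsSigma n ψ ∧ IsPi n χ ∧ φ = Fml.or ψ χ

/-- `Δ₀⁰` formulas of second-order arithmetic: only bounded first-order
quantifiers; free set variables (set parameters) are allowed. -/
inductive Delta0SO : Fml → Prop
  | eq (t u : Term) : Delta0SO (.eq t u)
  | lt (t u : Term) : Delta0SO (.lt t u)
  | mem (t : Term) (i : ℕ) : Delta0SO (.mem t i)
  | not {φ : Fml} : Delta0SO φ → Delta0SO (.not φ)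
  | and {φ ψ : Fml} : Delta0SO φ → Delta0SO ψ → Delta0SO (.and φ ψ)
  | or {φ ψ : Fml} : Delta0SO φ → Delta0SO ψ → Delta0SO (.or φ ψ)
  | imp {φ ψ : Fml} : Delta0SO φ → Delta0SO ψ → Delta0SO (.imp φ ψ)
  | ball (x : ℕ) (t : Term) {φ : Fml} : Delta0SO φ → Delta0SO (.ball x t φ)
  | bex (x : ℕ) (t : Term) {φ : Fml} : Delta0SO φ → Delta0SO (.bex x t φ)

mutual
  /-- `Σₙ⁰` formulas of the second-order arithmetic hierarchy
  (set parameters allowed, no set quantifiers). -/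
  inductive SigmaSO : ℕ → Fml → Prop
    | delta0 {n : ℕ} {φ : Fml} : Delta0SO φ → SigmaSO n φ
    | ofPi {n : ℕ} {φ : Fml} : PiSO n φ → SigmaSO (n + 1) φ
    | ex (x : ℕ) {n : ℕ} {φ : Fml} : SigmaSO (n + 1) φ → SigmaSO (n + 1) (.ex x φ)
  /-- `Πₙ⁰` formulas of the second-order arithmetic hierarchy. -/
  inductive PiSO : ℕ → Fml → Prop
    | delta0 {n : ℕ} {φ : Fml} : Delta0SO φ → PiSO n φ
    | ofSigma {n : ℕ} {φ : Fml} : SigmaSO n φ → PiSO (n + 1) φ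
    | all (x : ℕ) {n : ℕ} {φ : Fml} : PiSO (n + 1) φ → PiSO (n + 1) (.all x φ)
end

/-! ## First-order theories -/

/-- `PA⁻`: the theory of non-negative parts of discretely ordered rings. -/
structure PAminus (S : Str) : Prop where
  add_assoc : ∀ a b c, S.add (S.add a b) c = S.add a (S.add b c)
  add_comm : ∀ a b, S.add a b = S.add b a
  mul_assoc : ∀ a b c, S.mul (S.mul a b) c = S.mul a (S.mul b c)
  mul_comm : ∀ a b, S.mul a b = S.mul b a
  distrib : ∀ a b c, S.mul a (S.add b c) = S.add (S.mul a b) (S.mul a c)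
  add_zero : ∀ a, S.add a S.zero = a
  mul_zero : ∀ a, S.mul a S.zero = S.zero
  mul_one : ∀ a, S.mul a S.one = a
  lt_irrefl : ∀ a, ¬ S.lt a a
  lt_trans : ∀ a b c, S.lt a b → S.lt b c → S.lt a c
  lt_total : ∀ a b, S.lt a b ∨ a = b ∨ S.lt b a
  add_lt_add : ∀ a b c, S.lt a b → S.lt (S.add a c) (S.add b c)
  mul_lt_mul : ∀ a b c, S.lt a b → S.lt S.zero c → S.lt (S.mul a c) (S.mul b c)
  zero_lt_one : S.lt S.zero S.one
  zero_le : ∀ a, a = S.zero ∨ S.lt S.zero a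
  discrete : ∀ a b, S.lt a b → S.add a S.one = b ∨ S.lt (S.add a S.one) b
  pred : ∀ a, S.lt S.zero a → ∃ b, S.add b S.one = a
  sub : ∀ a b, S.lt a b → ∃ c, S.add a c = b

/-- The induction scheme for the class `Γ` of formulas
(parameters are allowed via the ambient valuation `v`). -/
def IndFor (S : Str) (Γ : Fml → Prop) : Prop :=
  ∀ φ : Fml, Γ φ → ∀ (v : ℕ → S.M) (x : ℕ),
    Sat0 S (upd v x S.zero) φ →
    (∀ m, Sat0 S (upd v x m) φ → Sat0 S (upd v x (S.add m S.one)) φ) →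
    ∀ m, Sat0 S (upd v x m) φ

/-- The collection scheme for the class `Γ`:
`(∀ x < a ∃ y φ) → (∃ b ∀ x < a ∃ y < b φ)`. -/
def CollFor (S : Str) (Γ : Fml → Prop) : Prop :=
  ∀ φ : Fml, Γ φ → ∀ (v : ℕ → S.M) (x y : ℕ), x ≠ y → ∀ a : S.M,
    (∀ m, S.lt m a → ∃ k, Sat0 S (upd (upd v x m) y k) φ) →
    ∃ b, ∀ m, S.lt m a → ∃ k, S.lt k b ∧ Sat0 S (upd (upd v x m) y k) φ

/-- `IΔ₀` (over `PA⁻`). -/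
def IDelta0 (S : Str) : Prop := PAminus S ∧ IndFor S Delta0

/-- `IΣₙ` (over `PA⁻`; note `Δ₀ ⊆ Σₙ`, so this includes `IΔ₀`). -/
def ISigma (S : Str) (n : ℕ) : Prop := PAminus S ∧ IndFor S (IsSigma n)

/-- `BΣₙ`: the `Σₙ`-collection scheme, including `IΔ₀` (over `PA⁻`). -/
def BSigma (S : Str) (n : ℕ) : Prop := IDelta0 S ∧ CollFor S (IsSigma n)

/-- The weak regularity principle `WRφ` for all `φ` in the class `Γ`:
the universal closure of `(∀ x ∃ y < a φ(x,y)) → (∃ y < a ∀ b ∃ x > b φ(x,y))`.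
Here `x, y` are the two displayed variables and all other free variables of
`φ` are parameters, interpreted by the ambient valuation `v`. -/
def WRFor (S : Str) (Γ : Fml → Prop) : Prop :=
  ∀ φ : Fml, Γ φ → ∀ (v : ℕ → S.M) (x y : ℕ), x ≠ y → ∀ a : S.M,
    (∀ m, ∃ k, S.lt k a ∧ Sat0 S (upd (upd v x m) y k) φ) →
    ∃ k, S.lt k a ∧ ∀ b, ∃ m, S.lt b m ∧ Sat0 S (upd (upd v x m) y k) φ

/-! ## Second-order theories -/

/-- Second-order induction scheme for the class `Γ`, with set parameters
from the second-order universe `X`. -/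
def IndForSO (S : Str) (X : Set (Set S.M)) (Γ : Fml → Prop) : Prop :=
  ∀ φ : Fml, Γ φ → ∀ (v : ℕ → S.M) (w : ℕ → Set S.M), (∀ i, w i ∈ X) → ∀ x : ℕ,
    Sat S X (upd v x S.zero) w φ →
    (∀ m, Sat S X (upd v x m) w φ → Sat S X (upd v x (S.add m S.one)) w φ) →
    ∀ m, Sat S X (upd v x m) w φ

/-- Second-order collection scheme for the class `Γ`. -/
def CollForSO (S : Str) (X : Set (Set S.M)) (Γ : Fml → Prop) : Prop :=
  ∀ φ : Fml, Γ φ → ∀ (v : ℕ → S.M) (w : ℕ → Set S.M), (∀ i, w i ∈ X) →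
    ∀ (x y : ℕ), x ≠ y → ∀ a : S.M,
    (∀ m, S.lt m a → ∃ k, Sat S X (upd (upd v x m) y k) w φ) →
    ∃ b, ∀ m, S.lt m a → ∃ k, S.lt k b ∧ Sat S X (upd (upd v x m) y k) w φ

/-- `Δ₁⁰`-comprehension. -/
def Delta1CA (S : Str) (X : Set (Set S.M)) : Prop :=
  ∀ φ ψ : Fml, SigmaSO 1 φ → PiSO 1 ψ →
    ∀ (v : ℕ → S.M) (w : ℕ → Set S.M), (∀ i, w i ∈ X) → ∀ x : ℕ,
    (∀ m, Sat S X (upd v x m) w φ ↔ Sat S X (upd v x m) w ψ) →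
    ∃ A ∈ X, ∀ m, m ∈ A ↔ Sat S X (upd v x m) w φ

/-- `Σₙ`-comprehension for first-order formulas with parameters from `M`. -/
def SigmaCA (S : Str) (X : Set (Set S.M)) (n : ℕ) : Prop :=
  ∀ φ : Fml, IsSigma n φ → ∀ (v : ℕ → S.M) (x : ℕ),
    ∃ A ∈ X, ∀ m, m ∈ A ↔ Sat0 S (upd v x m) φ

/-- `RCA₀`. -/
def RCA0 (S : Str) (X : Set (Set S.M)) : Prop :=
  PAminus S ∧ IndForSO S X (SigmaSO 1) ∧ Delta1CA S X

/-- `Σ₁⁰`-separation; over `RCA₀` this is equivalent to weak Kőnig's lemma. -/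
def Sigma1Sep (S : Str) (X : Set (Set S.M)) : Prop :=
  ∀ φ ψ : Fml, SigmaSO 1 φ → SigmaSO 1 ψ →
    ∀ (v : ℕ → S.M) (w : ℕ → Set S.M), (∀ i, w i ∈ X) → ∀ x : ℕ,
    (∀ m, ¬ (Sat S X (upd v x m) w φ ∧ Sat S X (upd v x m) w ψ)) →
    ∃ A ∈ X, ∀ m, (Sat S X (upd v x m) w φ → m ∈ A) ∧ (m ∈ A → ¬ Sat S X (upd v x m) w ψ)

/-- `WKL₀`, rendered as `RCA₀` plus `Σ₁⁰`-separation (which is equivalent,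
over `RCA₀`, to weak Kőnig's lemma). -/
def WKL0 (S : Str) (X : Set (Set S.M)) : Prop := RCA0 S X ∧ Sigma1Sep S X

/-- `BΣₙ⁰`: the second-order `Σₙ⁰`-collection scheme (including `IΔ₀⁰`,
over `PA⁻`). -/
def BSigmaSO (S : Str) (X : Set (Set S.M)) (n : ℕ) : Prop :=
  PAminus S ∧ IndForSO S X Delta0SO ∧ CollForSO S X (SigmaSO n)

/-- `IΣₙ⁰`: the second-order `Σₙ⁰`-induction scheme, over `RCA₀`. -/
def ISigmaSO (S : Str) (X : Set (Set S.M)) (n : ℕ) : Prop :=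
  RCA0 S X ∧ IndForSO S X (SigmaSO n)

/-! ## Exponentiation and binary digits -/

/-- Satisfaction of a three-variable formula `E(x₀, x₁, x₂)` at `(a, b, c)`. -/
def ExpAt (S : Str) (E : Fml) (a b c : S.M) : Prop :=
  Sat0 S (fun i => if i = 0 then a else if i = 1 then b else c) E

/-- `E(x₀,x₁,x₂)` is a `Δ₀` definition of the (total) exponentiation function
`x₀ ^ x₁ = x₂`.  The existence of such an `E` expresses `exp`
(the totality of exponentiation). -/
structure IsExpDef (S : Str) (E : Fml) : Prop where
  delta0 : Delta0 E
  base : ∀ a, ExpAt S E a S.zero S.one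
  total : ∀ a b, ∃ c, ExpAt S E a b c
  unique : ∀ a b c c', ExpAt S E a b c → ExpAt S E a b c' → c = c'
  step : ∀ a b c, ExpAt S E a b c → ExpAt S E a (S.add b S.one) (S.mul c a)

/-- `exp`: the totality of exponentiation (via a `Δ₀` definition of its
graph). -/
def SatExp (S : Str) : Prop := ∃ E : Fml, IsExpDef S E

/-! ## Embeddings, end extensions and elementarity -/

/-- An embedding of arithmetic structures. -/
structure Emb (S K : Str) where
  j : S.M → K.M
  inj : Function.Injective j
  zero : j S.zero = K.zero
  one : j S.one = K.one
  add : ∀ a b, j (S.add a b) = K.add (j a) (j b)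
  mul : ∀ a b, j (S.mul a b) = K.mul (j a) (j b)
  lt_iff : ∀ a b, S.lt a b ↔ K.lt (j a) (j b)

/-- The extension along `e` is an end extension: every element of `K` not in
the image of `M` exceeds every element of `M`. -/
def IsEndExt {S K : Str} (e : Emb S K) : Prop :=
  ∀ b : K.M, b ∉ Set.range e.j → ∀ a : S.M, K.lt (e.j a) b

/-- The extension along `e` is proper. -/
def IsProper {S K : Str} (e : Emb S K) : Prop := ¬ Function.Surjective e.j

/-- The extension along `e` is `Σₙ`-elementary: all `Σₙ` formulas with
parameters from `M` are absolute between `M` and `K`. -/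
def SigmaElem {S K : Str} (e : Emb S K) (n : ℕ) : Prop :=
  ∀ φ : Fml, IsSigma n φ → ∀ v : ℕ → S.M,
    (Sat0 S v φ ↔ Sat0 K (fun i => e.j (v i)) φ)

/-- `K ⊨ M‑IΣₙ` (for an extension `e : M → K`): induction up to any `a ∈ M`
for `Σₙ` formulas with parameters from `K`. -/
def MISigma {S K : Str} (e : Emb S K) (n : ℕ) : Prop :=
  ∀ φ : Fml, IsSigma n φ → ∀ (v : ℕ → K.M) (x : ℕ) (a : S.M),
    Sat0 K (upd v x K.zero) φ →
    (∀ m, K.lt m (e.j a) → (Sat0 K (upd v x m) φ → Sat0 K (upd v x (K.add m K.one)) φ)) →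
    ∀ m, K.lt m (e.j a) → Sat0 K (upd v x m) φ

/-- The `x`-th binary digit of `c ∈ K` is `1`, computed via a `Δ₀` definition
`E` of exponentiation on the ground model `S` (here `x` lies under the image
of `S`): there are `x', p ∈ M` with `j x' = x`, `p = 2 ^ x'`, and `u, v ∈ K`
with `c = u·(2p) + p + v` and `v < p`. -/
def BitVia {S K : Str} (e : Emb S K) (E : Fml) (x c : K.M) : Prop :=
  ∃ x' p : S.M, e.j x' = x ∧ ExpAt S E (S.add S.one S.one) x' p ∧
    ∃ u v : K.M, K.lt v (e.j p) ∧
      c = K.add (K.add (K.mul u (K.add (e.j p) (e.j p))) (e.j p)) v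

/-! ## The second-order restricted ultrapower -/

/-- `A` is cofinal (unbounded) in `S`. -/
def Cofinal (S : Str) (A : Set S.M) : Prop := ∀ b : S.M, ∃ x ∈ A, S.lt b x

/-- The pairing term `⟨x, y⟩ = (x + y)·(x + y) + x`. -/
def pairS (S : Str) (x y : S.M) : S.M := S.add (S.mul (S.add x y) (S.add x y)) x

/-- The graph of `f : M → M`, coded as a subset of `M` via pairing. -/
def graphOf (S : Str) (f : S.M → S.M) : Set S.M := {m | ∃ x, m = pairS S x (f x)}

/-- `f` is a total function `M → M` lying in the second-order universe `X`
(its coded graph belongs to `X`).  The collection of such `f` is the class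
`ℱ` of the restricted ultrapower. -/
def FuncIn (S : Str) (X : Set (Set S.M)) (f : S.M → S.M) : Prop := graphOf S f ∈ X

/-- `U` is an ultrafilter on the Boolean algebra `X`, all of whose elements
are cofinal in `M`. -/
structure UltraOn (S : Str) (X U : Set (Set S.M)) : Prop where
  subset : U ⊆ X
  univ_mem : Set.univ ∈ U
  empty_not_mem : ∅ ∉ U
  inter_mem : ∀ A ∈ U, ∀ B ∈ U, A ∩ B ∈ U
  superset_mem : ∀ A ∈ U, ∀ B ∈ X, A ⊆ B → B ∈ U
  ultra : ∀ A ∈ X, A ∈ U ∨ Aᶜ ∈ U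
  cofinal : ∀ A ∈ U, Cofinal S A

/-- A realization of the second-order restricted ultrapower `ℱ/𝒰` of `S`
with respect to the second-order universe `X` and the ultrafilter `U`:
a structure `K` whose elements are exactly the classes `cls f hf = [f]` of
total functions `f ∈ ℱ`, where `[f] = [g]` iff `f = g` on a set in `U`, with
pointwise arithmetic operations, order decided by `U`, and the inherited
second-order membership relation `memK` serving as the second-order expansion. -/
structure RUP (S : Str) (X U : Set (Set S.M)) : Type 1 where
  K : Str
  cls : (f : S.M → S.M) → FuncIn S X f → K.M
  memK : K.M → Set S.M → Prop
  const_in : ∀ a : S.M, FuncIn S X (fun _ => a)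
  surj : ∀ b : K.M, ∃ (f : S.M → S.M) (hf : FuncIn S X f), cls f hf = b
  eq_iff : ∀ (f : S.M → S.M) (hf : FuncIn S X f) (g : S.M → S.M) (hg : FuncIn S X g),
      (cls f hf = cls g hg) ↔ {i : S.M | f i = g i} ∈ U
  lt_iff : ∀ (f : S.M → S.M) (hf : FuncIn S X f) (g : S.M → S.M) (hg : FuncIn S X g),
      K.lt (cls f hf) (cls g hg) ↔ {i : S.M | S.lt (f i) (g i)} ∈ U
  zero_eq : K.zero = cls (fun _ => S.zero) (const_in S.zero)
  one_eq : K.one = cls (fun _ => S.one) (const_in S.one)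
  add_eq : ∀ (f : S.M → S.M) (hf : FuncIn S X f) (g : S.M → S.M) (hg : FuncIn S X g)
      (h : S.M → S.M) (hh : FuncIn S X h), (∀ i, h i = S.add (f i) (g i)) →
      K.add (cls f hf) (cls g hg) = cls h hh
  mul_eq : ∀ (f : S.M → S.M) (hf : FuncIn S X f) (g : S.M → S.M) (hg : FuncIn S X g)
      (h : S.M → S.M) (hh : FuncIn S X h), (∀ i, h i = S.mul (f i) (g i)) →
      K.mul (cls f hf) (cls g hg) = cls h hh
  mem_iff : ∀ (f : S.M → S.M) (hf : FuncIn S X f) (A : Set S.M), A ∈ X →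
      (memK (cls f hf) A ↔ {i : S.M | f i ∈ A} ∈ U)

/-- The canonical embedding `M → ℱ/𝒰` via constant functions. -/
def RUP.emb {S : Str} {X U : Set (Set S.M)} (R : RUP S X U) (a : S.M) : R.K.M :=
  R.cls (fun _ => a) (R.const_in a)

/-- The subset of `ℱ/𝒰` induced by `A ⊆ M`. -/
def RUP.setImg {S : Str} {X U : Set (Set S.M)} (R : RUP S X U) (A : Set S.M) :
    Set R.K.M := {b | R.memK b A}

/-- The second-order part of the expanded ultrapower `(ℱ/𝒰, 𝒳)`:
the (injected) copy of `X`. -/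
def RUP.X2 {S : Str} {X U : Set (Set S.M)} (R : RUP S X U) : Set (Set R.K.M) :=
  (fun A => R.setImg A) '' X

end PaperArith

namespace PaperArith

/-! ## Arithmetic in models of `PA⁻` -/

section Arithmetic

variable {S : Str} [hS : Fact (PAminus S)]

instance : CommSemiring S.M where
  add := S.add
  mul := S.mul
  zero := S.zero
  one := S.one
  add_assoc := hS.out.add_assoc
  add_comm := hS.out.add_comm
  zero_add a := (hS.out.add_comm _ _).trans (hS.out.add_zero a)
  add_zero := hS.out.add_zero
  mul_assoc := hS.out.mul_assoc
  mul_comm := hS.out.mul_comm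
  one_mul a := (hS.out.mul_comm _ _).trans (hS.out.mul_one a)
  mul_one := hS.out.mul_one
  zero_mul a := (hS.out.mul_comm _ _).trans (hS.out.mul_zero a)
  mul_zero := hS.out.mul_zero
  left_distrib := hS.out.distrib
  right_distrib a b c := by
    have h := hS.out.distrib c a b
    rw [hS.out.mul_comm c, hS.out.mul_comm c, hS.out.mul_comm c] at h
    exact h
  nsmul := @nsmulRec _ ⟨S.zero⟩ ⟨S.add⟩
  npow := @npowRec _ ⟨S.one⟩ ⟨S.mul⟩

noncomputable instance : LinearOrder S.M where
  lt := S.lt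
  le a b := S.lt a b ∨ a = b
  le_refl a := Or.inr rfl
  le_trans a b c := by
    rintro (h | rfl) (h' | rfl)
    · exact Or.inl (hS.out.lt_trans _ _ _ h h')
    · exact Or.inl h
    · exact Or.inl h'
    · exact Or.inr rfl
  lt_iff_le_not_ge a b := by
    constructor
    · intro h
      refine ⟨Or.inl h, ?_⟩
      rintro (h' | rfl)
      · exact hS.out.lt_irrefl _ (hS.out.lt_trans _ _ _ h h')
      · exact hS.out.lt_irrefl _ h
    · rintro ⟨h | rfl, h'⟩
      · exact h
      · exact absurd (Or.inr rfl) h'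
  le_antisymm a b := by
    rintro (h | rfl) (h' | h')
    · exact absurd (hS.out.lt_trans _ _ _ h h') (hS.out.lt_irrefl _)
    · exact h'.symm
    · rfl
    · rfl
  le_total a b := by
    rcases hS.out.lt_total a b with h | h | h
    · exact Or.inl (Or.inl h)
    · exact Or.inl (Or.inr h)
    · exact Or.inr (Or.inl h)
  toDecidableLE := Classical.decRel _

theorem add_lt_add_right_of_lt {a b : S.M} (c : S.M) (h : a < b) : a + c < b + c :=
  hS.out.add_lt_add a b c h

instance : IsStrictOrderedRing S.M where
  add_le_add_left a b h c := by
    rcases h with h | rfl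
    · exact (add_lt_add_right_of_lt c h).le
    · exact le_rfl
  le_of_add_le_add_left a b c h := by
    by_contra hc
    have := add_lt_add_right_of_lt a (not_le.1 hc)
    rw [add_comm c, add_comm b] at this
    exact absurd h (not_le.2 this)
  zero_le_one := Or.inl hS.out.zero_lt_one
  exists_pair_ne := ⟨0, 1, fun h => hS.out.lt_irrefl S.one (by
    have h0 := hS.out.zero_lt_one
    have h' : S.zero = S.one := h
    rwa [h'] at h0)⟩
  mul_lt_mul_of_pos_left a ha b c hbc := by
    rw [mul_comm a, mul_comm a]
    exact hS.out.mul_lt_mul b c a hbc ha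
  mul_lt_mul_of_pos_right c hc a b hab := hS.out.mul_lt_mul a b c hab hc

theorem zero_le_model (a : S.M) : 0 ≤ a :=
  (hS.out.zero_le a).elim (fun h => Or.inr h.symm) Or.inl

instance : CanonicallyOrderedAdd S.M where
  exists_add_of_le {a b} h := by
    rcases h with h | rfl
    · obtain ⟨c, hc⟩ := hS.out.sub a b h
      exact ⟨c, hc.symm⟩
    · exact ⟨0, (add_zero a).symm⟩
  le_add_self a b := le_add_of_nonneg_left (zero_le_model b)
  le_self_add a b := le_add_of_nonneg_right (zero_le_model b)

theorem lt_add_one_iff_le {a b : S.M} : a < b + 1 ↔ a ≤ b := by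
  constructor
  · intro h
    by_contra hc
    rcases hS.out.discrete b a (not_le.1 hc) with h' | h'
    · exact absurd (h'.le.trans_lt' h) (lt_irrefl a)
    · exact absurd (lt_trans h h') (lt_irrefl a)
  · intro h
    exact lt_of_le_of_lt h (lt_add_of_pos_right b one_pos)

theorem eq_zero_or_succ (a : S.M) : a = 0 ∨ ∃ b, a = b + 1 := by
  rcases hS.out.zero_le a with h | h
  · exact Or.inl h
  · obtain ⟨b, hb⟩ := hS.out.pred a h
    exact Or.inr ⟨b, hb.symm⟩

theorem lt_succ_self_model (a : S.M) : a < a + 1 := lt_add_one_iff_le.2 le_rfl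

theorem dvd_of_dvd_add {p a b : S.M} (hp : p ∣ a) (h : p ∣ a + b) : p ∣ b := by
  obtain ⟨u, rfl⟩ := hp
  obtain ⟨w, hw⟩ := h
  rcases le_total u w with huw | huw
  · obtain ⟨t, rfl⟩ := exists_add_of_le huw
    rw [mul_add] at hw
    exact ⟨t, add_left_cancel hw⟩
  · obtain ⟨t, rfl⟩ := exists_add_of_le huw
    have : p * w + (p * t + b) = p * w + 0 := by
      calc p * w + (p * t + b) = p * (w + t) + b := by ring
        _ = p * w := hw
        _ = p * w + 0 := (add_zero _).symm
    have h0 := add_left_cancel this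
    have hb : b = 0 := le_antisymm (h0 ▸ le_add_self) (zero_le_model b)
    rw [hb]
    exact dvd_zero p

theorem remainder_unique {a q q' y y' : S.M} (hy : y < a) (hy' : y' < a)
    (h : q * a + y = q' * a + y') : y = y' := by
  have key : ∀ {q q' y y' : S.M}, y < a → q * a + y = q' * a + y' → q' ≤ q := by
    intro q q' y y' hy h
    by_contra hc
    obtain ⟨t, rfl⟩ := exists_add_of_le (not_le.1 hc).le
    have ht : t ≠ 0 := by rintro rfl; simp at hc
    have h1 : q * a + y = q * a + (t * a + y') := by rw [h]; ring
    have h2 := add_left_cancel h1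
    obtain rfl | ⟨s, rfl⟩ := eq_zero_or_succ t
    · exact ht rfl
    · have : a ≤ y := by
        rw [h2]
        calc a ≤ a + (s * a + y') := le_self_add
          _ = (s + 1) * a + y' := by ring
      exact absurd hy (not_lt.2 this)
  have hq : q = q' := le_antisymm (key hy' h.symm) (key hy h)
  subst hq
  exact add_left_cancel h

/-- The moduli `1 + (i + 1) m` behave like pairwise coprime numbers for
indices below `L` as soon as `m` is divisible by `1, …, L`. -/
theorem betaModulus_dvd {L m i j E : S.M} (hm : ∀ k < L, k + 1 ∣ m) (hi : i < L) (hj : j < L)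
    (hij : i ≠ j) (h : 1 + (j + 1) * m ∣ (1 + (i + 1) * m) * E) : 1 + (j + 1) * m ∣ E := by
  have hmE : 1 + (j + 1) * m ∣ m * E := by
    rcases lt_or_gt_of_ne hij with hlt | hlt
    · obtain ⟨t, rfl⟩ := exists_add_of_le hlt.le
      obtain rfl | ⟨s, rfl⟩ := eq_zero_or_succ t
      · simp at hlt
      · have hs : s + 1 ∣ m := hm s (lt_of_lt_of_le (lt_succ_self_model s)
          (le_add_self.trans hj.le))
        have h1 : 1 + (i + (s + 1) + 1) * m ∣
            (i + 1) * E * (1 + (i + (s + 1) + 1) * m) + (s + 1) * E := by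
          have h2 := Dvd.dvd.mul_left h (i + (s + 1) + 1)
          have e : (i + (s + 1) + 1) * ((1 + (i + 1) * m) * E) =
            (i + 1) * E * (1 + (i + (s + 1) + 1) * m) + (s + 1) * E := by ring
          rwa [e] at h2
        have h3 := dvd_of_dvd_add (Dvd.intro_left _ rfl) h1
        obtain ⟨r, rfl⟩ := hs
        have e : (s + 1) * r * E = (s + 1) * E * r := by ring
        rw [e]
        exact Dvd.dvd.mul_right h3 r
    · obtain ⟨t, rfl⟩ := exists_add_of_le hlt.le
      obtain rfl | ⟨s, rfl⟩ := eq_zero_or_succ t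
      · simp at hlt
      · have hs : s + 1 ∣ m := hm s (lt_of_lt_of_le (lt_succ_self_model s)
          (le_add_self.trans hi.le))
        have h2 := Dvd.dvd.mul_left h (j + 1)
        have h1 : 1 + (j + 1) * m ∣ (j + 1) * ((1 + (j + (s + 1) + 1) * m) * E) + (s + 1) * E := by
          have e : (j + 1) * ((1 + (j + (s + 1) + 1) * m) * E) + (s + 1) * E =
            (j + (s + 1) + 1) * E * (1 + (j + 1) * m) := by ring
          rw [e]
          exact Dvd.intro_left _ rfl
        have h3 := dvd_of_dvd_add h2 h1
        obtain ⟨r, rfl⟩ := hs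
        have e : (s + 1) * r * E = (s + 1) * E * r := by ring
        rw [e]
        exact Dvd.dvd.mul_right h3 r
  have h4 : 1 + (j + 1) * m ∣ (j + 1) * (m * E) + E := ⟨E, by ring⟩
  exact dvd_of_dvd_add (Dvd.dvd.mul_left hmE _) h4

end Arithmetic

/-! ## Substitution in terms and formulas -/

/-- Simultaneous substitution of terms for variables in a term. -/
def tsub (ρ : ℕ → Term) : Term → Term
  | .var i => ρ i
  | .zero => .zero
  | .one => .one
  | .add t u => .add (tsub ρ t) (tsub ρ u)
  | .mul t u => .mul (tsub ρ t) (tsub ρ u)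

theorem tval_tsub (S : Str) (v : ℕ → S.M) (ρ : ℕ → Term) (t : Term) :
    tval S v (tsub ρ t) = tval S (fun i => tval S v (ρ i)) t := by
  induction t <;> simp_all [tsub, tval]

/-- Capture-avoiding substitution of terms for the free number variables of a formula.
A quantifier below `k` other quantifiers binds the variable with index `2 * k + 1`. -/
def fsub : (ℕ → Term) → ℕ → Fml → Fml
  | ρ, _, .eq t u => .eq (tsub ρ t) (tsub ρ u)
  | ρ, _, .lt t u => .lt (tsub ρ t) (tsub ρ u)
  | ρ, _, .mem t i => .mem (tsub ρ t) i
  | ρ, k, .not φ => .not (fsub ρ k φ)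
  | ρ, k, .and φ ψ => .and (fsub ρ k φ) (fsub ρ k ψ)
  | ρ, k, .or φ ψ => .or (fsub ρ k φ) (fsub ρ k ψ)
  | ρ, k, .imp φ ψ => .imp (fsub ρ k φ) (fsub ρ k ψ)
  | ρ, k, .all x φ => .all (2 * k + 1) (fsub (upd ρ x (.var (2 * k + 1))) (k + 1) φ)
  | ρ, k, .ex x φ => .ex (2 * k + 1) (fsub (upd ρ x (.var (2 * k + 1))) (k + 1) φ)
  | ρ, k, .ball x t φ =>
      .ball (2 * k + 1) (tsub ρ t) (fsub (upd ρ x (.var (2 * k + 1))) (k + 1) φ)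
  | ρ, k, .bex x t φ =>
      .bex (2 * k + 1) (tsub ρ t) (fsub (upd ρ x (.var (2 * k + 1))) (k + 1) φ)
  | ρ, k, .sall i φ => .sall i (fsub ρ k φ)
  | ρ, k, .sex i φ => .sex i (fsub ρ k φ)

/-- The terms `ρ i` do not depend on the variables `2 * j + 1` with `k ≤ j`. -/
def FreshFrom (S : Str) (ρ : ℕ → Term) (k : ℕ) : Prop :=
  ∀ i (v : ℕ → S.M) j m, k ≤ j → tval S (upd v (2 * j + 1) m) (ρ i) = tval S v (ρ i)

theorem FreshFrom.upd {S : Str} {ρ : ℕ → Term} {k : ℕ} (h : FreshFrom S ρ k) (x : ℕ) :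
    FreshFrom S (upd ρ x (.var (2 * k + 1))) (k + 1) := by
  intro i v j m hj
  by_cases hi : i = x
  · simp [PaperArith.upd, hi, tval]
    intro h; omega
  · have := h i v j m (by omega)
    simpa [PaperArith.upd, hi] using this

theorem FreshFrom.val_upd {S : Str} {ρ : ℕ → Term} {k : ℕ} (h : FreshFrom S ρ k) (x : ℕ)
    (v : ℕ → S.M) (m : S.M) :
    (fun i => tval S (PaperArith.upd v (2 * k + 1) m)
      (PaperArith.upd ρ x (.var (2 * k + 1)) i)) =
      PaperArith.upd (fun i => tval S v (ρ i)) x m := by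
  funext i
  by_cases hi : i = x
  · simp [PaperArith.upd, hi, tval]
  · have := h i v k m le_rfl
    simpa [PaperArith.upd, hi] using this

theorem sat_fsub (S : Str) (X : Set (Set S.M)) (φ : Fml) :
    ∀ (ρ : ℕ → Term) (k : ℕ) (v : ℕ → S.M) (w : ℕ → Set S.M), FreshFrom S ρ k →
      (Sat S X v w (fsub ρ k φ) ↔ Sat S X (fun i => tval S v (ρ i)) w φ) := by
  induction φ with
  | eq t u => intro ρ k v w h; simp only [fsub, Sat, tval_tsub]
  | lt t u => intro ρ k v w h; simp only [fsub, Sat, tval_tsub]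
  | mem t i => intro ρ k v w h; simp only [fsub, Sat, tval_tsub]
  | not φ ih => intro ρ k v w h; simp only [fsub, Sat, ih ρ k v w h]
  | and φ ψ ih ih' => intro ρ k v w h; simp only [fsub, Sat, ih ρ k v w h, ih' ρ k v w h]
  | or φ ψ ih ih' => intro ρ k v w h; simp only [fsub, Sat, ih ρ k v w h, ih' ρ k v w h]
  | imp φ ψ ih ih' => intro ρ k v w h; simp only [fsub, Sat, ih ρ k v w h, ih' ρ k v w h]
  | all x φ ih =>
    intro ρ k v w h
    simp only [fsub, Sat, ih _ _ _ w (h.upd x), h.val_upd]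
  | ex x φ ih =>
    intro ρ k v w h
    simp only [fsub, Sat, ih _ _ _ w (h.upd x), h.val_upd]
  | ball x t φ ih =>
    intro ρ k v w h
    simp only [fsub, Sat, ih _ _ _ w (h.upd x), h.val_upd, tval_tsub]
  | bex x t φ ih =>
    intro ρ k v w h
    simp only [fsub, Sat, ih _ _ _ w (h.upd x), h.val_upd, tval_tsub]
  | sall i φ ih => intro ρ k v w h; simp only [fsub, Sat, ih ρ k v _ h]
  | sex i φ ih => intro ρ k v w h; simp only [fsub, Sat, ih ρ k v _ h]

/-- A class of formulas closed under substitution. -/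
def Stable (Γ : Fml → Prop) : Prop := ∀ φ ρ k, Γ φ → Γ (fsub ρ k φ)

theorem stable_delta0 : Stable Delta0 := by
  intro φ ρ k h
  induction h generalizing ρ k with
  | eq t u => exact .eq _ _
  | lt t u => exact .lt _ _
  | not _ ih => exact .not (ih _ _)
  | and _ _ ih ih' => exact .and (ih _ _) (ih' _ _)
  | or _ _ ih ih' => exact .or (ih _ _) (ih' _ _)
  | imp _ _ ih ih' => exact .imp (ih _ _) (ih' _ _)
  | ball x t _ ih => exact .ball _ _ (ih _ _)
  | bex x t _ ih => exact .bex _ _ (ih _ _)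

mutual
theorem IsSigma.fsub {n : ℕ} {φ : Fml} (h : IsSigma n φ) (ρ : ℕ → Term) (k : ℕ) :
    IsSigma n (fsub ρ k φ) := by
  cases h with
  | delta0 h => exact .delta0 (stable_delta0 _ _ _ h)
  | ofPi h => exact .ofPi (h.fsub ρ k)
  | ex x h => exact .ex _ (h.fsub _ _)
theorem IsPi.fsub {n : ℕ} {φ : Fml} (h : IsPi n φ) (ρ : ℕ → Term) (k : ℕ) :
    IsPi n (fsub ρ k φ) := by
  cases h with
  | delta0 h => exact .delta0 (stable_delta0 _ _ _ h)
  | ofSigma h => exact .ofSigma (h.fsub ρ k)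
  | all x h => exact .all _ (h.fsub _ _)
end

theorem stable_isSigma (n : ℕ) : Stable (IsSigma n) := fun _ ρ k h => h.fsub ρ k

theorem stable_isPi (n : ℕ) : Stable (IsPi n) := fun _ ρ k h => h.fsub ρ k

theorem stable_sigma0Sigma (n : ℕ) : Stable (Sigma0Sigma n) := by
  intro φ ρ k h
  induction h generalizing ρ k with
  | ofSigma h => exact .ofSigma (h.fsub _ _)
  | not _ ih => exact .not (ih _ _)
  | and _ _ ih ih' => exact .and (ih _ _) (ih' _ _)
  | or _ _ ih ih' => exact .or (ih _ _) (ih' _ _)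
  | imp _ _ ih ih' => exact .imp (ih _ _) (ih' _ _)
  | ball x t _ ih => exact .ball _ _ (ih _ _)
  | bex x t _ ih => exact .bex _ _ (ih _ _)

/-! ## Definable relations -/

/-- A context: a type `C` of tuples of elements of `S`, with its coordinate functions. -/
class Ctx (S : Str) (C : Type) where
  coords : Set (C → S.M)

instance (S : Str) : Ctx S Unit := ⟨∅⟩

instance (S : Str) (C : Type) [Ctx S C] : Ctx S (C × S.M) :=
  ⟨{g | (∃ f ∈ Ctx.coords, g = fun p => f p.1) ∨ g = Prod.snd}⟩

section Renaming

variable {S : Str}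

/-- A renaming that keeps variable `1`, and makes the other variables even, positive and
disjoint for different indices `i`. -/
def ren (i j : ℕ) : Term := if j = 1 then .var 1 else .var (2 * Nat.pair i j + 2)

/-- The parameters for terms renamed by `ren`. -/
def glue {α : Type} (τ : ℕ → ℕ → α) (k : ℕ) : α :=
  τ (Nat.unpair (k / 2 - 1)).1 (Nat.unpair (k / 2 - 1)).2

theorem glue_ren {α : Type} (τ : ℕ → ℕ → α) (i j : ℕ) :
    glue τ (2 * Nat.pair i j + 2) = τ i j := by
  simp [glue]

theorem tval_ren {C : Type} (τ : ℕ → ℕ → C → S.M) (i : ℕ) (T : Term) (c : C) (m k : S.M) :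
    tval S (upd (upd (fun j => glue τ j c) 1 m) 0 k) (tsub (ren i) T) =
      tval S (upd (fun j => τ i j c) 1 m) T := by
  rw [tval_tsub]
  congr 1
  funext j
  by_cases hj : j = 1
  · simp [ren, hj, tval, upd]
  · simp [ren, hj, tval, upd, glue_ren]

theorem tval_upd_ren (v : ℕ → S.M) (i j : ℕ) (T : Term) (m : S.M) (hj : 1 ≤ j) :
    tval S (upd v (2 * j + 1) m) (tsub (ren i) T) = tval S v (tsub (ren i) T) := by
  rw [tval_tsub, tval_tsub]
  congr 1
  funext l
  have h : 2 * Nat.pair i l + 2 ≠ 2 * j + 1 := by omega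
  have h' : 1 ≠ 2 * j + 1 := by omega
  by_cases hl : l = 1 <;> simp [ren, hl, tval, upd, h]
  intro; omega

end Renaming

section Definability

variable {S : Str} [hS : Fact (PAminus S)]

/-- Polynomial functions of the coordinates of a context. -/
inductive Poly {C : Type} [Ctx S C] : (C → S.M) → Prop
  | coord {f : C → S.M} : f ∈ Ctx.coords → Poly f
  | const (a : S.M) : Poly fun _ => a
  | add {f g : C → S.M} : Poly f → Poly g → Poly fun c => f c + g c
  | mul {f g : C → S.M} : Poly f → Poly g → Poly fun c => f c * g c

/-- Maps between contexts with polynomial coordinates. -/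
def Sub {C D : Type} [Ctx S C] [Ctx S D] (F : D → C) : Prop :=
  ∀ f : C → S.M, f ∈ Ctx.coords → Poly fun d => f (F d)

theorem Poly.comp {C D : Type} [Ctx S C] [Ctx S D] {f : C → S.M} (hf : Poly f) {F : D → C}
    (hF : Sub (S := S) F) : Poly fun d => f (F d) := by
  induction hf with
  | coord h => exact hF _ h
  | const a => exact .const a
  | add _ _ ih ih' => exact .add ih ih'
  | mul _ _ ih ih' => exact .mul ih ih'

theorem sub_unit {D : Type} [Ctx S D] : Sub (S := S) fun _ : D => () :=
  fun _ h => absurd h (Set.notMem_empty _)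

theorem Sub.snoc {C D : Type} [Ctx S C] [Ctx S D] {F : D → C} (hF : Sub (S := S) F)
    {f : D → S.M} (hf : Poly f) : Sub (S := S) fun d => (F d, f d) := by
  rintro g (⟨h, hh, rfl⟩ | rfl)
  · exact hF h hh
  · exact hf

theorem sub_fst {C : Type} [Ctx S C] : Sub (S := S) fun p : C × S.M => p.1 :=
  fun f h => .coord (Or.inl ⟨f, h, rfl⟩)

theorem Sub.comp_fst {C D : Type} [Ctx S C] [Ctx S D] {F : D → C} (hF : Sub (S := S) F) :
    Sub (S := S) fun p : D × S.M => F p.1 :=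
  fun f h => (hF f h).comp sub_fst

section Projections

variable {C : Type} [Ctx S C]

theorem poly0 : Poly fun c : C × S.M => c.2 := .coord (Or.inr rfl)

theorem Poly.lift {f : C → S.M} (h : Poly f) : Poly fun c : C × S.M => f c.1 := h.comp sub_fst

theorem poly1 : Poly fun c : (C × S.M) × S.M => c.1.2 := poly0.lift

theorem poly2 : Poly fun c : ((C × S.M) × S.M) × S.M => c.1.1.2 := poly1.lift

theorem poly3 : Poly fun c : (((C × S.M) × S.M) × S.M) × S.M => c.1.1.1.2 := poly2.lift

end Projections

theorem Poly.exists_term {C : Type} [Ctx S C] {f : C × S.M → S.M} (hf : Poly f) :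
    ∃ (T : Term) (τ : ℕ → C → S.M), (∀ j, Poly (τ j)) ∧
      ∀ c m, f (c, m) = tval S (upd (fun j => τ j c) 1 m) T := by
  have pair : ∀ (T₁ T₂ : Term) (τ₁ τ₂ : ℕ → C → S.M), (∀ j, Poly (τ₁ j)) → (∀ j, Poly (τ₂ j)) →
      ∃ (U₁ U₂ : Term) (τ : ℕ → C → S.M), (∀ j, Poly (τ j)) ∧
      ∀ c m, tval S (upd (fun j => τ₁ j c) 1 m) T₁ = tval S (upd (fun j => τ j c) 1 m) U₁ ∧
        tval S (upd (fun j => τ₂ j c) 1 m) T₂ = tval S (upd (fun j => τ j c) 1 m) U₂ := by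
    intro T₁ T₂ τ₁ τ₂ h₁ h₂
    refine ⟨tsub (ren 0) T₁, tsub (ren 1) T₂, glue fun i => if i = 0 then τ₁ else τ₂, ?_, ?_⟩
    · intro j
      simp only [glue]
      split_ifs
      · exact h₁ _
      · exact h₂ _
    · intro c m
      have e : ∀ v : ℕ → S.M, upd (upd v 1 m) 0 (v 0) = upd v 1 m := by
        intro v
        funext i
        by_cases h0 : i = 0 <;> simp [upd, h0]
      have key := fun i T => tval_ren (fun i => if i = 0 then τ₁ else τ₂) i T c m
        (glue (fun i => if i = 0 then τ₁ else τ₂) 0 c)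
      simp only [e (fun j => glue (fun i => if i = 0 then τ₁ else τ₂) j c)] at key
      constructor
      · rw [key]; simp
      · rw [key]; simp
  induction hf with
  | coord h =>
    rcases h with ⟨g, hg, rfl⟩ | rfl
    · exact ⟨.var 0, fun _ => g, fun _ => .coord hg, fun c m => by simp [tval, upd]⟩
    · exact ⟨.var 1, fun _ _ => 0, fun _ => .const 0, fun c m => by simp [tval, upd]⟩
  | const a => exact ⟨.var 0, fun _ _ => a, fun _ => .const a, fun c m => by simp [tval, upd]⟩
  | add _ _ ih ih' =>
    obtain ⟨T₁, τ₁, h₁, e₁⟩ := ih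
    obtain ⟨T₂, τ₂, h₂, e₂⟩ := ih'
    obtain ⟨U₁, U₂, τ, h, e⟩ := pair T₁ T₂ τ₁ τ₂ h₁ h₂
    refine ⟨.add U₁ U₂, τ, h, fun c m => ?_⟩
    dsimp only
    rw [e₁, e₂, (e c m).1, (e c m).2]
    rfl
  | mul _ _ ih ih' =>
    obtain ⟨T₁, τ₁, h₁, e₁⟩ := ih
    obtain ⟨T₂, τ₂, h₂, e₂⟩ := ih'
    obtain ⟨U₁, U₂, τ, h, e⟩ := pair T₁ T₂ τ₁ τ₂ h₁ h₂
    refine ⟨.mul U₁ U₂, τ, h, fun c m => ?_⟩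
    dsimp only
    rw [e₁, e₂, (e c m).1, (e c m).2]
    rfl

open Classical in
theorem exists_normal_form {Γ : Fml → Prop} (hΓ : Stable Γ) {C : Type} [Ctx S C] {φ : Fml}
    (hφ : Γ φ) (J : ℕ → Prop) {σ : ℕ → C × S.M → S.M} (hσ : ∀ i, Poly (σ i)) :
    ∃ ψ, Γ ψ ∧ ∃ τ : ℕ → C → S.M, (∀ i, Poly (τ i)) ∧ ∀ c m k,
      (Sat0 S (fun i => if J i then k else σ i (c, m)) φ ↔
        Sat0 S (upd (upd (fun i => τ i c) 1 m) 0 k) ψ) := by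
  choose T τ hτ e using fun i => (hσ i).exists_term
  refine ⟨fsub (fun i => if J i then .var 0 else tsub (ren i) (T i)) 1 φ, hΓ _ _ _ hφ,
    glue τ, fun j => hτ _ _, fun c m k => ?_⟩
  rw [Sat0, Sat0, sat_fsub]
  · have : (fun i => if J i then k else σ i (c, m)) = fun i =>
        tval S (upd (upd (fun i => glue τ i c) 1 m) 0 k)
          (if J i then .var 0 else tsub (ren i) (T i)) := by
      funext i
      by_cases hi : J i
      · simp [hi, tval, upd]
      · simp only [hi, if_false]
        rw [tval_ren, e]
    rw [this]
  · intro i v j m hj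
    by_cases hi : J i
    · simp [hi, tval, upd]
    · simp only [hi, if_false]
      exact tval_upd_ren v i j _ m hj

/-- The relation `R` is defined by a formula in `Γ` with polynomial parameters. -/
def Dfn (Γ : Fml → Prop) {C : Type} [Ctx S C] (R : C → Prop) : Prop :=
  ∃ φ, Γ φ ∧ ∃ τ : ℕ → C → S.M, (∀ i, Poly (τ i)) ∧ ∀ c, R c ↔ Sat0 S (fun i => τ i c) φ

section Closure

variable {Γ : Fml → Prop} {C : Type} [Ctx S C]

theorem Dfn.congr {R R' : C → Prop} (h : Dfn (S := S) Γ R) (e : ∀ c, R' c ↔ R c) :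
    Dfn (S := S) Γ R' := by
  obtain rfl : R' = R := funext fun c => propext (e c)
  exact h

theorem Dfn.mono {Γ' : Fml → Prop} (hΓ : ∀ φ, Γ φ → Γ' φ) {R : C → Prop}
    (h : Dfn (S := S) Γ R) : Dfn (S := S) Γ' R := by
  obtain ⟨φ, hφ, h⟩ := h
  exact ⟨φ, hΓ φ hφ, h⟩

theorem Dfn.subst {D : Type} [Ctx S D] {R : C → Prop} (h : Dfn (S := S) Γ R) {F : D → C}
    (hF : Sub (S := S) F) : Dfn (S := S) Γ fun d => R (F d) := by
  obtain ⟨φ, hφ, τ, hτ, e⟩ := h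
  exact ⟨φ, hφ, fun i d => τ i (F d), fun i => (hτ i).comp hF, fun d => e (F d)⟩

theorem Dfn.unary {Γ' : Fml → Prop} {op : Fml → Fml} {o : Prop → Prop}
    (hop : ∀ φ, Γ φ → Γ' (op φ)) (ho : ∀ v φ, Sat0 S v (op φ) ↔ o (Sat0 S v φ))
    {R : C → Prop} (h : Dfn (S := S) Γ R) : Dfn (S := S) Γ' fun c => o (R c) := by
  obtain ⟨φ, hφ, τ, hτ, e⟩ := h
  refine ⟨op φ, hop φ hφ, τ, hτ, fun c => ?_⟩
  dsimp only
  rw [ho, propext (e c)]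

theorem Dfn.exists_common {Γ' : Fml → Prop} (hΓ : Stable Γ) (hΓ' : Stable Γ') {R R' : C → Prop}
    (h : Dfn (S := S) Γ R) (h' : Dfn (S := S) Γ' R') :
    ∃ φ ψ, Γ φ ∧ Γ' ψ ∧ ∃ τ : ℕ → C → S.M, (∀ i, Poly (τ i)) ∧
      ∀ c, (R c ↔ Sat0 S (fun i => τ i c) φ) ∧ (R' c ↔ Sat0 S (fun i => τ i c) ψ) := by
  obtain ⟨φ, hφ, τ, hτ, e⟩ := h
  obtain ⟨φ', hφ', τ', hτ', e'⟩ := h'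
  have fresh : ∀ b, FreshFrom S (fun i => .var (2 * Nat.pair b i)) 0 := by
    intro b i v j m _
    have : 2 * Nat.pair b i ≠ 2 * j + 1 := by omega
    simp [tval, upd, this]
  refine ⟨fsub (fun i => .var (2 * Nat.pair 0 i)) 0 φ, fsub (fun i => .var (2 * Nat.pair 1 i)) 0 φ',
    hΓ _ _ _ hφ, hΓ' _ _ _ hφ', fun k => if (Nat.unpair (k / 2)).1 = 0
      then τ (Nat.unpair (k / 2)).2 else τ' (Nat.unpair (k / 2)).2, ?_, ?_⟩
  · intro i
    dsimp only
    split_ifs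
    · exact hτ _
    · exact hτ' _
  · intro c
    rw [Sat0, Sat0, sat_fsub _ _ _ _ _ _ _ (fresh 0), sat_fsub _ _ _ _ _ _ _ (fresh 1), e, e']
    simp [tval, Sat0]

theorem Dfn.binary {Γ' Γ'' : Fml → Prop} (hΓ : Stable Γ) (hΓ' : Stable Γ') {op : Fml → Fml → Fml}
    {o : Prop → Prop → Prop} (hop : ∀ φ ψ, Γ φ → Γ' ψ → Γ'' (op φ ψ))
    (ho : ∀ v φ ψ, Sat0 S v (op φ ψ) ↔ o (Sat0 S v φ) (Sat0 S v ψ))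
    {R R' : C → Prop} (h : Dfn (S := S) Γ R) (h' : Dfn (S := S) Γ' R') :
    Dfn (S := S) Γ'' fun c => o (R c) (R' c) := by
  obtain ⟨φ, ψ, hφ, hψ, τ, hτ, e⟩ := h.exists_common hΓ hΓ' h'
  refine ⟨op φ ψ, hop φ ψ hφ hψ, τ, hτ, fun c => ?_⟩
  dsimp only
  rw [ho, propext (e c).1, propext (e c).2]

theorem Dfn.quantifier (hΓ : Stable Γ) {P : C → S.M → Prop}
    (h : Dfn (S := S) Γ fun p : C × S.M => P p.1 p.2) {t : C → S.M} (ht : Poly t) :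
    ∃ φ, Γ φ ∧ ∃ τ : ℕ → C → S.M, (∀ i, Poly (τ i)) ∧ τ 0 = t ∧
      ∀ c m, P c m ↔ Sat0 S (upd (fun i => τ i c) 1 m) φ := by
  obtain ⟨φ, hφ, σ, hσ, e⟩ := h
  obtain ⟨ψ, hψ, τ, hτ, e'⟩ := exists_normal_form hΓ hφ (fun _ => False) hσ
  refine ⟨ψ, hψ, fun i => if i = 0 then t else τ i, ?_, rfl, fun c m => ?_⟩
  · intro i
    dsimp only
    split_ifs
    · exact ht
    · exact hτ i
  · have h1 : P c m ↔ _ := e (c, m)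
    have h2 := e' c m (t c)
    simp only [if_false] at h2
    rw [h1, h2]
    dsimp only
    have : upd (upd (fun i => τ i c) 1 m) 0 (t c) =
        upd (fun i => (if i = 0 then t else τ i) c) 1 m := by
      funext i
      by_cases h0 : i = 0 <;> simp [upd, h0]
    rw [this]

theorem Dfn.ball (hΓ : Stable Γ) (hop : ∀ x t φ, Γ φ → Γ (.ball x t φ)) {P : C → S.M → Prop}
    (h : Dfn (S := S) Γ fun p : C × S.M => P p.1 p.2) {t : C → S.M} (ht : Poly t) :
    Dfn (S := S) Γ fun c => ∀ m, m < t c → P c m := by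
  obtain ⟨φ, hφ, τ, hτ, rfl, e⟩ := h.quantifier hΓ ht
  refine ⟨.ball 1 (.var 0) φ, hop _ _ _ hφ, τ, hτ, fun c => ?_⟩
  simp only [e]
  rfl

theorem Dfn.all {Γ' : Fml → Prop} (hΓ : Stable Γ) (hop : ∀ x φ, Γ φ → Γ' (.all x φ))
    {P : C → S.M → Prop} (h : Dfn (S := S) Γ fun p : C × S.M => P p.1 p.2) :
    Dfn (S := S) Γ' fun c => ∀ m, P c m := by
  obtain ⟨φ, hφ, τ, hτ, -, e⟩ := h.quantifier hΓ (.const 0)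
  refine ⟨.all 1 φ, hop _ _ hφ, τ, hτ, fun c => ?_⟩
  simp only [e]
  rfl

theorem Dfn.ex {Γ' : Fml → Prop} (hΓ : Stable Γ) (hop : ∀ x φ, Γ φ → Γ' (.ex x φ))
    {P : C → S.M → Prop} (h : Dfn (S := S) Γ fun p : C × S.M => P p.1 p.2) :
    Dfn (S := S) Γ' fun c => ∃ m, P c m := by
  obtain ⟨φ, hφ, τ, hτ, -, e⟩ := h.quantifier hΓ (.const 0)
  refine ⟨.ex 1 φ, hop _ _ hφ, τ, hτ, fun c => ?_⟩
  simp only [e]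
  rfl

theorem Dfn.eq (hΓ : ∀ φ, Delta0 φ → Γ φ) {f g : C → S.M} (hf : Poly f) (hg : Poly g) :
    Dfn (S := S) Γ fun c => f c = g c := by
  refine ⟨.eq (.var 0) (.var 1), hΓ _ (.eq _ _), fun i => if i = 0 then f else g, ?_, fun c => ?_⟩
  · intro i
    dsimp only
    split_ifs <;> assumption
  · simp [Sat0, Sat, tval]

theorem Dfn.lt (hΓ : ∀ φ, Delta0 φ → Γ φ) {f g : C → S.M} (hf : Poly f) (hg : Poly g) :
    Dfn (S := S) Γ fun c => f c < g c := by
  refine ⟨.lt (.var 0) (.var 1), hΓ _ (.lt _ _), fun i => if i = 0 then f else g, ?_, fun c => ?_⟩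
  · intro i
    dsimp only
    split_ifs <;> assumption
  · simp only [Sat0, Sat, tval]
    simp
    rfl

end Closure

/-- A binary relation given by a definable relation on `(Unit × M) × M` is given by a formula
with two displayed variables. -/
theorem Dfn.exists_formula₂ {Γ : Fml → Prop} (hΓ : Stable Γ) {R : S.M → S.M → Prop}
    (h : Dfn (S := S) Γ fun p : (Unit × S.M) × S.M => R p.1.2 p.2) :
    ∃ φ, Γ φ ∧ ∃ v : ℕ → S.M, ∀ x y, R x y ↔ Sat0 S (upd (upd v 1 x) 0 y) φ := by
  classical
  obtain ⟨φ, hφ, σ, hσ, e⟩ := h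
  obtain ⟨ψ, hψ, τ, hτ, e'⟩ := exists_normal_form hΓ hφ (fun _ => False) hσ
  obtain ⟨χ, hχ, υ, hυ, e''⟩ := exists_normal_form hΓ hψ (fun i => i = 1) hτ
  refine ⟨χ, hχ, fun i => υ i (), fun x y => ?_⟩
  have h1 : R x y ↔ _ := e (((), x), y)
  have h2 := e' ((), x) y (τ 0 ((), x))
  have h3 := e'' () x y
  simp only [if_false] at h2
  rw [h1, h2, ← h3]
  have : upd (upd (fun i => τ i ((), x)) 1 y) 0 (τ 0 ((), x)) =
      fun i => if i = 1 then y else τ i ((), x) := by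
    funext i
    by_cases h0 : i = 0
    · simp [upd, h0]
    · simp [upd, h0]
  rw [this]
  congr!

theorem Dfn.exists_formula₁ {Γ : Fml → Prop} (hΓ : Stable Γ) {R : S.M → Prop}
    (h : Dfn (S := S) Γ fun p : Unit × S.M => R p.2) :
    ∃ φ, Γ φ ∧ ∃ v : ℕ → S.M, ∀ x, R x ↔ Sat0 S (upd v 1 x) φ := by
  obtain ⟨φ, hφ, τ, -, -, e⟩ := Dfn.quantifier (P := fun _ m => R m) hΓ h (.const 0)
  exact ⟨φ, hφ, fun i => τ i (), fun x => e () x⟩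

theorem poly_upd {C : Type} [Ctx S C] {τ : ℕ → C → S.M} (hτ : ∀ i, Poly (τ i)) {f : C → S.M}
    (hf : Poly f) (x i : ℕ) : Poly fun c => upd (fun i => τ i c) x (f c) i := by
  by_cases h : i = x
  · simpa only [upd, h, if_true] using hf
  · simpa only [upd, h, if_false] using hτ i

theorem poly_tval {C : Type} [Ctx S C] {τ : ℕ → C → S.M} (hτ : ∀ i, Poly (τ i)) (t : Term) :
    Poly fun c => tval S (fun i => τ i c) t := by
  induction t with
  | var i => exact hτ i
  | zero => exact .const _
  | one => exact .const _
  | add _ _ ih ih' => exact .add ih ih'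
  | mul _ _ ih ih' => exact .mul ih ih'

theorem dfn_formula {Γ : Fml → Prop} {φ : Fml} (hφ : Γ φ) {C : Type} [Ctx S C]
    {τ : ℕ → C → S.M} (hτ : ∀ i, Poly (τ i)) : Dfn (S := S) Γ fun c => Sat0 S (fun i => τ i c) φ :=
  ⟨φ, hφ, τ, hτ, fun _ => Iff.rfl⟩

end Definability

/-! ## Closure properties of classes of relations -/

/-- A class of relations on contexts. -/
abbrev RelClass (S : Str) : Type 1 := ∀ (C : Type) [Ctx S C], (C → Prop) → Prop

theorem RelClass.congr {S : Str} {𝒟 : RelClass S} {C : Type} [Ctx S C] {R R' : C → Prop} (h : 𝒟 C R)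
    (e : ∀ c, R' c ↔ R c) : 𝒟 C R' := by
  obtain rfl : R' = R := funext fun c => propext (e c)
  exact h

/-- The relations defined by formulas in `Γ`. -/
def DfnBy (S : Str) [Fact (PAminus S)] (Γ : Fml → Prop) : RelClass S :=
  fun _ _ R => Dfn (S := S) Γ R

section Hierarchy

variable {S : Str} [hS : Fact (PAminus S)]

/-- Classes containing the bounded relations and closed under positive connectives,
bounded quantifiers and polynomial substitutions. -/
structure PosClosed (𝒟 : RelClass S) : Prop where
  delta0 : ∀ {C : Type} [Ctx S C] {R : C → Prop}, Dfn (S := S) Delta0 R → 𝒟 C R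
  subst : ∀ {C D : Type} [Ctx S C] [Ctx S D] {R : C → Prop}, 𝒟 C R →
    ∀ {F : D → C}, Sub (S := S) F → 𝒟 D fun d => R (F d)
  and : ∀ {C : Type} [Ctx S C] {R R' : C → Prop}, 𝒟 C R → 𝒟 C R' → 𝒟 C fun c => R c ∧ R' c
  or : ∀ {C : Type} [Ctx S C] {R R' : C → Prop}, 𝒟 C R → 𝒟 C R' → 𝒟 C fun c => R c ∨ R' c
  ball : ∀ {C : Type} [Ctx S C] {t : C → S.M} {P : C → S.M → Prop}, Poly t →
    𝒟 (C × S.M) (fun p => P p.1 p.2) → 𝒟 C fun c => ∀ m, m < t c → P c m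
  bex : ∀ {C : Type} [Ctx S C] {t : C → S.M} {P : C → S.M → Prop}, Poly t →
    𝒟 (C × S.M) (fun p => P p.1 p.2) → 𝒟 C fun c => ∃ m, m < t c ∧ P c m

namespace PosClosed

variable {𝒟 : RelClass S} (h𝒟 : PosClosed 𝒟) {C : Type} [Ctx S C]
include h𝒟

theorem lt {f g : C → S.M} (hf : Poly f) (hg : Poly g) : 𝒟 C fun c => f c < g c :=
  h𝒟.delta0 (.lt (fun _ h => h) hf hg)

theorem eq {f g : C → S.M} (hf : Poly f) (hg : Poly g) : 𝒟 C fun c => f c = g c :=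
  h𝒟.delta0 (.eq (fun _ h => h) hf hg)

theorem rel₁ {R : S.M → Prop} (h : 𝒟 (Unit × S.M) fun p => R p.2) {f : C → S.M}
    (hf : Poly f) : 𝒟 C fun c => R (f c) :=
  h𝒟.subst h (sub_unit.snoc hf)

theorem rel₂ {R : S.M → S.M → Prop} (h : 𝒟 ((Unit × S.M) × S.M) fun p => R p.1.2 p.2)
    {f g : C → S.M} (hf : Poly f) (hg : Poly g) : 𝒟 C fun c => R (f c) (g c) :=
  h𝒟.subst h ((sub_unit.snoc hf).snoc hg)

theorem rel₃ {R : S.M → S.M → S.M → Prop}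
    (h : 𝒟 (((Unit × S.M) × S.M) × S.M) fun p => R p.1.1.2 p.1.2 p.2)
    {f g k : C → S.M} (hf : Poly f) (hg : Poly g) (hk : Poly k) :
    𝒟 C fun c => R (f c) (g c) (k c) :=
  h𝒟.subst h (((sub_unit.snoc hf).snoc hg).snoc hk)

theorem subst₁ {P : C → S.M → Prop} (h : 𝒟 (C × S.M) fun p => P p.1 p.2) {D : Type} [Ctx S D]
    {F : D → C} {f : D → S.M} (hF : Sub (S := S) F) (hf : Poly f) : 𝒟 D fun d => P (F d) (f d) :=
  h𝒟.subst h (hF.snoc hf)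

end PosClosed

/-- Positively closed classes that are closed under negation. -/
structure Closed (𝒟 : RelClass S) : Prop extends PosClosed 𝒟 where
  not : ∀ {C : Type} [Ctx S C] {R : C → Prop}, 𝒟 C R → 𝒟 C fun c => ¬ R c

namespace Closed

variable {𝒟 : RelClass S} (h𝒟 : Closed 𝒟) {C : Type} [Ctx S C]
include h𝒟

theorem imp {R R' : C → Prop} (h : 𝒟 C R) (h' : 𝒟 C R') : 𝒟 C fun c => R c → R' c :=
  RelClass.congr (h𝒟.or (h𝒟.not h) h') fun _ => imp_iff_not_or

theorem iff {R R' : C → Prop} (h : 𝒟 C R) (h' : 𝒟 C R') : 𝒟 C fun c => (R c ↔ R' c) :=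
  RelClass.congr (h𝒟.and (h𝒟.imp h h') (h𝒟.imp h' h)) fun _ => iff_iff_implies_and_implies

end Closed

theorem closed_dfnBy {Γ : Fml → Prop} (hΓ : Stable Γ) (h0 : ∀ φ, Delta0 φ → Γ φ)
    (hnot : ∀ φ, Γ φ → Γ (.not φ)) (hand : ∀ φ ψ, Γ φ → Γ ψ → Γ (.and φ ψ))
    (hor : ∀ φ ψ, Γ φ → Γ ψ → Γ (.or φ ψ)) (hball : ∀ x t φ, Γ φ → Γ (.ball x t φ)) :
    Closed (DfnBy S Γ) := by
  have hn : ∀ {C : Type} [Ctx S C] {R : C → Prop}, Dfn (S := S) Γ R →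
      Dfn (S := S) Γ fun c => ¬ R c :=
    fun h => h.unary hnot fun _ _ => Iff.rfl
  exact
    { delta0 := fun h => h.mono h0
      subst := fun h _ hF => h.subst hF
      and := fun h h' => h.binary hΓ hΓ hand (fun _ _ _ => Iff.rfl) h'
      or := fun h h' => h.binary hΓ hΓ hor (fun _ _ _ => Iff.rfl) h'
      ball := fun ht h => h.ball hΓ hball ht
      bex := fun {C} _ {t P} ht h => by
        have h1 : Dfn (S := S) Γ fun p : C × S.M => ¬ P p.1 p.2 := hn h
        refine Dfn.congr (hn (h1.ball (P := fun c m => ¬ P c m) hΓ hball ht)) fun c => ?_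
        push Not
        rfl
      not := hn }

theorem closed_delta0 : Closed (DfnBy S Delta0) :=
  closed_dfnBy stable_delta0 (fun _ h => h) (fun _ => .not) (fun _ _ => .and) (fun _ _ => .or)
    fun _ _ _ => .ball _ _

theorem closed_sigma0Sigma (n : ℕ) : Closed (DfnBy S (Sigma0Sigma n)) :=
  closed_dfnBy (stable_sigma0Sigma n) (fun _ h => .ofSigma (.delta0 h)) (fun _ => .not)
    (fun _ _ => .and) (fun _ _ => .or) fun _ _ _ => .ball _ _

/-! ## The arithmetic hierarchy of relations -/

variable (S) in
/-- Relations on contexts with a `Σₖ` definition in prenex form. -/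
def Sig : ℕ → RelClass S
  | 0 => fun C _ R => Dfn (S := S) (C := C) Delta0 R
  | k + 1 => fun C _ R => ∃ P : C → S.M → Prop,
      Sig k (C × S.M) (fun p => ¬ P p.1 p.2) ∧ ∀ c, R c ↔ ∃ m, P c m

variable (S) in
/-- Relations whose complement is `Σₖ`. -/
def Pi (k : ℕ) : RelClass S := fun C _ R => Sig S k C fun c => ¬ R c

variable (S) in
/-- Relations that are both `Σₖ` and `Πₖ`. -/
def Delta (k : ℕ) : RelClass S := fun C _ R => Sig S k C R ∧ Pi S k C R

/-- The collection principle for a class of relations. -/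
def Collection (𝒟 : RelClass S) : Prop :=
  ∀ R : S.M → S.M → Prop, 𝒟 ((Unit × S.M) × S.M) (fun p => R p.1.2 p.2) →
    ∀ a, (∀ y, y < a → ∃ z, R y z) → ∃ b, ∀ y, y < a → ∃ z, z < b ∧ R y z

/-- The weak regularity principle for a class of relations. -/
def WeakRegularity (𝒟 : RelClass S) : Prop :=
  ∀ R : S.M → S.M → Prop, 𝒟 ((Unit × S.M) × S.M) (fun p => R p.1.2 p.2) →
    ∀ a, (∀ x, ∃ y, y < a ∧ R x y) → ∃ y, y < a ∧ ∀ b, ∃ x, b < x ∧ R x y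

/-- The least number principle for a class of relations. -/
def LeastNumber (𝒟 : RelClass S) : Prop :=
  ∀ P : S.M → Prop, 𝒟 (Unit × S.M) (fun p => P p.2) → (∃ x, P x) →
    ∃ x, P x ∧ ∀ y, y < x → ¬ P y

section Basic

variable {C D : Type} [Ctx S C] [Ctx S D] {k : ℕ}

theorem Sig.subst {R : C → Prop} (h : Sig S k C R) {F : D → C} (hF : Sub (S := S) F) :
    Sig S k D fun d => R (F d) := by
  induction k generalizing C D with
  | zero => exact Dfn.subst h hF
  | succ k ih =>
    obtain ⟨P, hP, e⟩ := h
    exact ⟨fun d m => P (F d) m, ih hP (hF.comp_fst.snoc poly0), fun d => e (F d)⟩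

theorem Pi.subst {R : C → Prop} (h : Pi S k C R) {F : D → C} (hF : Sub (S := S) F) :
    Pi S k D fun d => R (F d) :=
  Sig.subst h hF

theorem Sig.pi_not {R : C → Prop} (h : Sig S k C R) : Pi S k C fun c => ¬ R c :=
  RelClass.congr (𝒟 := Sig S k) h fun _ => not_not

theorem Sig.pi_succ {R : C → Prop} (h : Sig S k C R) : Pi S (k + 1) C R :=
  ⟨fun c _ => ¬ R c, (h.subst sub_fst).pi_not, fun _ => ⟨fun h => ⟨0, h⟩, fun ⟨_, h⟩ => h⟩⟩

theorem Pi.sig_succ {R : C → Prop} (h : Pi S k C R) : Sig S (k + 1) C R :=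
  ⟨fun c _ => R c, h.subst sub_fst, fun _ => ⟨fun h => ⟨0, h⟩, fun ⟨_, h⟩ => h⟩⟩

theorem Sig.succ {R : C → Prop} (h : Sig S k C R) : Sig S (k + 1) C R := by
  induction k generalizing C with
  | zero => exact Pi.sig_succ (closed_delta0.not h)
  | succ k ih =>
    obtain ⟨P, hP, e⟩ := h
    exact ⟨P, ih hP, e⟩

theorem Pi.succ {R : C → Prop} (h : Pi S k C R) : Pi S (k + 1) C R := Sig.succ h

theorem Sig.delta_succ {R : C → Prop} (h : Sig S k C R) : Delta S (k + 1) C R :=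
  ⟨h.succ, h.pi_succ⟩

theorem Pi.delta_succ {R : C → Prop} (h : Pi S k C R) : Delta S (k + 1) C R :=
  ⟨h.sig_succ, h.succ⟩

theorem Sig.of_delta0 {R : C → Prop} (h : Dfn (S := S) Delta0 R) : Sig S k C R := by
  induction k with
  | zero => exact h
  | succ k ih => exact ih.succ

theorem Pi.sig_ex {P : C → S.M → Prop} (h : Pi S k (C × S.M) fun p => P p.1 p.2) :
    Sig S (k + 1) C fun c => ∃ m, P c m :=
  ⟨P, h, fun _ => Iff.rfl⟩

theorem Sig.pi_all {P : C → S.M → Prop} (h : Sig S k (C × S.M) fun p => P p.1 p.2) :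
    Pi S (k + 1) C fun c => ∀ m, P c m :=
  ⟨fun c m => ¬ P c m, h.pi_not, fun _ => not_forall⟩

end Basic

theorem PosClosed.pi {k : ℕ} (h : PosClosed (Sig S k)) : PosClosed (Pi S k) where
  delta0 hR := h.delta0 (closed_delta0.not hR)
  subst hR _ hF := hR.subst hF
  and hR hR' := RelClass.congr (𝒟 := Sig S k) (h.or hR hR') fun _ => by tauto
  or hR hR' := RelClass.congr (𝒟 := Sig S k) (h.and hR hR') fun _ => by tauto
  ball {C _ t P} ht hP :=
    RelClass.congr (𝒟 := Sig S k) (h.bex (P := fun c m => ¬ P c m) ht hP) fun _ => by push Not; rfl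
  bex {C _ t P} ht hP :=
    RelClass.congr (𝒟 := Sig S k) (h.ball (P := fun c m => ¬ P c m) ht hP) fun _ => by push Not; rfl

theorem posClosed_sig_zero : PosClosed (Sig S 0) := closed_delta0.toPosClosed

theorem Sig.ex {k : ℕ} (hk : PosClosed (Sig S k)) {C : Type} [Ctx S C] {P : C → S.M → Prop}
    (h : Sig S (k + 1) (C × S.M) fun p => P p.1 p.2) : Sig S (k + 1) C fun c => ∃ m, P c m := by
  obtain ⟨A, hA, e⟩ := h
  have hA : Pi S k ((C × S.M) × S.M) fun p => A p.1 p.2 := hA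
  refine ⟨fun c s => ∃ m, m < s ∧ ∃ z, z < s ∧ A (c, m) z,
    hk.pi.bex poly0 (hk.pi.bex poly1 (hk.pi.subst₁ hA
      (sub_fst.comp_fst.comp_fst.snoc poly1) poly0)), fun c => ?_⟩
  constructor
  · rintro ⟨m, hm⟩
    obtain ⟨z, hz⟩ := (e (c, m)).1 hm
    exact ⟨max m z + 1, m, lt_add_one_iff_le.2 (le_max_left _ _), z,
      lt_add_one_iff_le.2 (le_max_right _ _), hz⟩
  · rintro ⟨s, m, -, z, -, hz⟩
    exact ⟨m, (e (c, m)).2 ⟨z, hz⟩⟩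

theorem Pi.all {k : ℕ} (hk : PosClosed (Sig S k)) {C : Type} [Ctx S C] {P : C → S.M → Prop}
    (h : Pi S (k + 1) (C × S.M) fun p => P p.1 p.2) : Pi S (k + 1) C fun c => ∀ m, P c m :=
  RelClass.congr (𝒟 := Sig S (k + 1)) (Sig.ex hk (P := fun c m => ¬ P c m) h) fun _ => not_forall

theorem Collection.sig_succ {k : ℕ} (hk : PosClosed (Sig S k)) (hc : Collection (Pi S k)) :
    Collection (Sig S (k + 1)) := by
  rintro R ⟨A, hA, e⟩ a ha
  have hA : Pi S k (((Unit × S.M) × S.M) × S.M) fun p => A p.1 p.2 := hA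
  obtain ⟨b, hb⟩ := hc (fun y s => ∃ z, z < s ∧ ∃ w, w < s ∧ A (((), y), z) w)
    (hk.pi.bex poly0 (hk.pi.bex poly1 (hk.pi.subst₁ hA
      ((sub_unit.snoc poly3).snoc poly1) poly0))) a (by
    intro y hy
    obtain ⟨z, hz⟩ := ha y hy
    obtain ⟨w, hw⟩ := (e (((), y), z)).1 hz
    exact ⟨max z w + 1, z, lt_add_one_iff_le.2 (le_max_left _ _), w,
      lt_add_one_iff_le.2 (le_max_right _ _), hw⟩)
  refine ⟨b, fun y hy => ?_⟩
  obtain ⟨s, hs, z, hz, w, -, hw⟩ := hb y hy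
  exact ⟨z, hz.trans hs, (e (((), y), z)).2 ⟨w, hw⟩⟩

theorem sub_const {C D : Type} [Ctx S C] [Ctx S D] (c : C) : Sub (S := S) fun _ : D => c :=
  fun f _ => .const (f c)

theorem PosClosed.sig_succ {k : ℕ} (hk : PosClosed (Sig S k)) (hc : Collection (Pi S k)) :
    PosClosed (Sig S (k + 1)) where
  delta0 hR := Sig.of_delta0 hR
  subst hR _ hF := hR.subst hF
  and := by
    rintro C _ R R' ⟨A, hA, e⟩ ⟨B, hB, e'⟩
    have hA : Pi S k (C × S.M) fun p => A p.1 p.2 := hA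
    have hB : Pi S k (C × S.M) fun p => B p.1 p.2 := hB
    refine ⟨fun c s => (∃ m, m < s ∧ A c m) ∧ ∃ m, m < s ∧ B c m,
      hk.pi.and (hk.pi.bex poly0 (hk.pi.subst₁ hA sub_fst.comp_fst poly0))
        (hk.pi.bex poly0 (hk.pi.subst₁ hB sub_fst.comp_fst poly0)), fun c => ?_⟩
    dsimp only
    rw [e, e']
    constructor
    · rintro ⟨⟨m, hm⟩, ⟨m', hm'⟩⟩
      exact ⟨max m m' + 1, ⟨m, lt_add_one_iff_le.2 (le_max_left _ _), hm⟩,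
        ⟨m', lt_add_one_iff_le.2 (le_max_right _ _), hm'⟩⟩
    · rintro ⟨s, ⟨m, -, hm⟩, ⟨m', -, hm'⟩⟩
      exact ⟨⟨m, hm⟩, ⟨m', hm'⟩⟩
  or := by
    rintro C _ R R' ⟨A, hA, e⟩ ⟨B, hB, e'⟩
    refine ⟨fun c m => A c m ∨ B c m, hk.pi.or hA hB, fun c => ?_⟩
    dsimp only
    rw [e, e', exists_or]
  ball := by
    rintro C _ t P ht ⟨A, hA, e⟩
    have hA : Pi S k ((C × S.M) × S.M) fun p => A p.1 p.2 := hA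
    refine ⟨fun c s => ∀ y, y < t c → ∃ z, z < s ∧ A (c, y) z,
      hk.pi.ball ht.lift (hk.pi.bex poly1 (hk.pi.subst₁ hA
        (sub_fst.comp_fst.comp_fst.snoc poly1) poly0)), fun c => ?_⟩
    constructor
    · intro h
      exact hc (fun y z => A (c, y) z)
        (hk.pi.subst₁ hA ((sub_const c).snoc poly1) poly0) (t c)
        fun y hy => (e (c, y)).1 (h y hy)
    · rintro ⟨s, hs⟩ y hy
      obtain ⟨z, -, hz⟩ := hs y hy
      exact (e (c, y)).2 ⟨z, hz⟩
  bex := by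
    rintro C _ t P ht ⟨A, hA, e⟩
    have hA : Pi S k ((C × S.M) × S.M) fun p => A p.1 p.2 := hA
    refine ⟨fun c s => ∃ y, y < t c ∧ ∃ z, z < s ∧ A (c, y) z,
      hk.pi.bex ht.lift (hk.pi.bex poly1 (hk.pi.subst₁ hA
        (sub_fst.comp_fst.comp_fst.snoc poly1) poly0)), fun c => ?_⟩
    constructor
    · rintro ⟨y, hy, h⟩
      obtain ⟨z, hz⟩ := (e (c, y)).1 h
      exact ⟨z + 1, y, hy, z, lt_succ_self_model z, hz⟩
    · rintro ⟨s, y, hy, z, -, hz⟩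
      exact ⟨y, hy, (e (c, y)).2 ⟨z, hz⟩⟩

theorem PosClosed.delta {k : ℕ} (h : PosClosed (Sig S k)) : Closed (Delta S k) where
  delta0 hR := ⟨h.delta0 hR, h.pi.delta0 hR⟩
  subst hR _ hF := ⟨hR.1.subst hF, hR.2.subst hF⟩
  and hR hR' := ⟨h.and hR.1 hR'.1, h.pi.and hR.2 hR'.2⟩
  or hR hR' := ⟨h.or hR.1 hR'.1, h.pi.or hR.2 hR'.2⟩
  ball ht hR := ⟨h.ball ht hR.1, h.pi.ball ht hR.2⟩
  bex ht hR := ⟨h.bex ht hR.1, h.pi.bex ht hR.2⟩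
  not hR := ⟨hR.2, hR.1.pi_not⟩

/-- Collection for `Πⱼ` with `j < k` yields closure of `Σₖ`. -/
theorem posClosed_sig {k : ℕ} (hc : ∀ j, j < k → Collection (Pi S j)) : PosClosed (Sig S k) := by
  induction k with
  | zero => exact posClosed_sig_zero
  | succ k ih => exact (ih fun j hj => hc j (by omega)).sig_succ (hc k (by omega))

/-! ## Formulas and relations of the hierarchy -/

theorem sig_pi_of_formula :
    (∀ k φ, IsSigma k φ → (∀ j, j < k → PosClosed (Sig S j)) → ∀ (C : Type) [Ctx S C]
      (τ : ℕ → C → S.M), (∀ i, Poly (τ i)) → Sig S k C fun c => Sat0 S (fun i => τ i c) φ) ∧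
    ∀ k φ, IsPi k φ → (∀ j, j < k → PosClosed (Sig S j)) → ∀ (C : Type) [Ctx S C]
      (τ : ℕ → C → S.M), (∀ i, Poly (τ i)) → Pi S k C fun c => Sat0 S (fun i => τ i c) φ := by
  let motive₁ : ∀ k φ, IsSigma k φ → Prop := fun k φ _ => (∀ j, j < k → PosClosed (Sig S j)) →
    ∀ (C : Type) [Ctx S C] (τ : ℕ → C → S.M), (∀ i, Poly (τ i)) →
      Sig S k C fun c => Sat0 S (fun i => τ i c) φ
  let motive₂ : ∀ k φ, IsPi k φ → Prop := fun k φ _ => (∀ j, j < k → PosClosed (Sig S j)) →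
    ∀ (C : Type) [Ctx S C] (τ : ℕ → C → S.M), (∀ i, Poly (τ i)) →
      Pi S k C fun c => Sat0 S (fun i => τ i c) φ
  have sigma_delta0 : ∀ {n φ} (h : Delta0 φ), motive₁ n φ (.delta0 h) :=
    fun h _ C _ τ hτ => Sig.of_delta0 (dfn_formula h hτ)
  have sigma_ofPi : ∀ {n φ} (h : IsPi n φ), motive₂ n φ h → motive₁ (n + 1) φ (.ofPi h) :=
    fun _ ih hc C _ τ hτ => (ih (fun j hj => hc j (by omega)) C τ hτ).sig_succ
  have sigma_ex : ∀ x {n φ} (h : IsSigma (n + 1) φ), motive₁ (n + 1) φ h →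
      motive₁ (n + 1) (.ex x φ) (.ex x h) := by
    intro x n φ _ ih hc C _ τ hτ
    exact Sig.ex (P := fun c m => Sat0 S (upd (fun i => τ i c) x m) φ) (hc n (by omega))
      (ih hc (C × S.M) (fun i p => upd (fun i => τ i p.1) x p.2 i)
        fun i => poly_upd (fun i => (hτ i).lift) poly0 x i)
  have pi_delta0 : ∀ {n φ} (h : Delta0 φ), motive₂ n φ (.delta0 h) :=
    fun h _ C _ τ hτ => Sig.of_delta0 (closed_delta0.not (dfn_formula h hτ))
  have pi_ofSigma : ∀ {n φ} (h : IsSigma n φ), motive₁ n φ h → motive₂ (n + 1) φ (.ofSigma h) :=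
    fun _ ih hc C _ τ hτ => (ih (fun j hj => hc j (by omega)) C τ hτ).pi_succ
  have pi_all : ∀ x {n φ} (h : IsPi (n + 1) φ), motive₂ (n + 1) φ h →
      motive₂ (n + 1) (.all x φ) (.all x h) := by
    intro x n φ _ ih hc C _ τ hτ
    exact Pi.all (P := fun c m => Sat0 S (upd (fun i => τ i c) x m) φ) (hc n (by omega))
      (ih hc (C × S.M) (fun i p => upd (fun i => τ i p.1) x p.2 i)
        fun i => poly_upd (fun i => (hτ i).lift) poly0 x i)
  exact ⟨fun _ _ h => IsSigma.rec (motive_1 := motive₁) (motive_2 := motive₂) sigma_delta0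
      sigma_ofPi sigma_ex pi_delta0 pi_ofSigma pi_all h,
    fun _ _ h => IsPi.rec (motive_1 := motive₁) (motive_2 := motive₂) sigma_delta0
      sigma_ofPi sigma_ex pi_delta0 pi_ofSigma pi_all h⟩

theorem IsSigma.sig {k : ℕ} {φ : Fml} (h : IsSigma k φ) (hc : ∀ j, j < k → PosClosed (Sig S j))
    {C : Type} [Ctx S C] {τ : ℕ → C → S.M} (hτ : ∀ i, Poly (τ i)) :
    Sig S k C fun c => Sat0 S (fun i => τ i c) φ :=
  sig_pi_of_formula.1 k φ h hc C τ hτ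

theorem IsPi.pi {k : ℕ} {φ : Fml} (h : IsPi k φ) (hc : ∀ j, j < k → PosClosed (Sig S j))
    {C : Type} [Ctx S C] {τ : ℕ → C → S.M} (hτ : ∀ i, Poly (τ i)) :
    Pi S k C fun c => Sat0 S (fun i => τ i c) φ :=
  sig_pi_of_formula.2 k φ h hc C τ hτ

theorem dfn_of_sig (k : ℕ) : ∀ {C : Type} [Ctx S C] {R : C → Prop},
    (Sig S k C R → Dfn (S := S) (IsSigma k) R) ∧ (Pi S k C R → Dfn (S := S) (IsPi k) R) := by
  induction k with
  | zero =>
    intro C _ R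
    refine ⟨fun h => Dfn.mono (fun _ => .delta0) h, fun h => Dfn.mono (fun _ => .delta0) ?_⟩
    exact Dfn.congr (closed_delta0.not h) fun _ => not_not.symm
  | succ k ih =>
    intro C _ R
    constructor
    · rintro ⟨P, hP, e⟩
      exact ((ih.2 hP).ex (Γ' := IsSigma (k + 1)) (stable_isPi k)
        fun x φ hφ => .ex x (.ofPi hφ)).congr e
    · rintro ⟨P, hP, e⟩
      refine ((ih.1 hP).all (P := fun c m => ¬ P c m) (Γ' := IsPi (k + 1)) (stable_isSigma k)
        fun x φ hφ => .all x (.ofSigma hφ)).congr fun c => ?_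
      rw [← not_exists, ← e c, not_not]

theorem Sig.dfn {k : ℕ} {C : Type} [Ctx S C] {R : C → Prop} (h : Sig S k C R) :
    Dfn (S := S) (IsSigma k) R :=
  (dfn_of_sig k).1 h

theorem Sigma0Sigma.delta {n : ℕ} {φ : Fml} (h : Sigma0Sigma n φ)
    (hc : ∀ j, j ≤ n → Collection (Pi S j)) {C : Type} [Ctx S C] {τ : ℕ → C → S.M}
    (hτ : ∀ i, Poly (τ i)) : Delta S (n + 1) C fun c => Sat0 S (fun i => τ i c) φ := by
  have hcl : Closed (Delta S (n + 1)) := (posClosed_sig fun j hj => hc j (by omega)).delta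
  induction h generalizing C with
  | ofSigma h =>
    exact (h.sig (fun j hj => posClosed_sig fun i hi => hc i (by omega)) hτ).delta_succ
  | not _ ih => exact hcl.not (ih hτ)
  | and _ _ ih ih' => exact hcl.and (ih hτ) (ih' hτ)
  | or _ _ ih ih' => exact hcl.or (ih hτ) (ih' hτ)
  | imp _ _ ih ih' => exact hcl.imp (ih hτ) (ih' hτ)
  | ball x t _ ih =>
    refine hcl.ball (P := fun c m => Sat0 S (upd (fun i => τ i c) x m) _)
      (t := fun c => tval S (fun i => τ i c) t) (poly_tval hτ t) ?_
    exact ih (τ := fun i (p : C × S.M) => upd (fun i => τ i p.1) x p.2 i)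
      fun i => poly_upd (fun i => (hτ i).lift) poly0 x i
  | bex x t _ ih =>
    refine hcl.bex (P := fun c m => Sat0 S (upd (fun i => τ i c) x m) _)
      (t := fun c => tval S (fun i => τ i c) t) (poly_tval hτ t) ?_
    exact ih (τ := fun i (p : C × S.M) => upd (fun i => τ i p.1) x p.2 i)
      fun i => poly_upd (fun i => (hτ i).lift) poly0 x i

end Hierarchy

section Principles

variable {S : Str} [hS : Fact (PAminus S)]

/-! ## Least number principles -/

theorem Closed.induction {𝒟 : RelClass S} (h𝒟 : Closed 𝒟) (hl : LeastNumber 𝒟)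
    {P : S.M → Prop} (hP : 𝒟 (Unit × S.M) fun p => P p.2) (h0 : P 0)
    (hs : ∀ x, P x → P (x + 1)) (x : S.M) : P x := by
  by_contra hx
  obtain ⟨y, hy, hmin⟩ := hl (fun x => ¬ P x) (h𝒟.not hP) ⟨x, hx⟩
  obtain rfl | ⟨z, rfl⟩ := eq_zero_or_succ y
  · exact hy h0
  · exact hy (hs z (not_not.1 (hmin z (lt_succ_self_model z))))

theorem leastNumber_delta0 (hI : IndFor S Delta0) : LeastNumber (DfnBy S Delta0) := by
  intro P hP ⟨x, hx⟩
  by_contra hc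
  push Not at hc
  have hQ : DfnBy S Delta0 (Unit × S.M) fun p => ∀ y, y < p.2 → ¬ P y :=
    closed_delta0.ball poly0 (closed_delta0.not (closed_delta0.rel₁ hP poly0))
  obtain ⟨φ, hφ, v, e⟩ := Dfn.exists_formula₁ (R := fun x => ∀ y, y < x → ¬ P y)
    stable_delta0 hQ
  have hall := hI φ hφ v 1
    ((e 0).1 fun y hy => absurd hy (not_lt.2 (zero_le_model y)))
    (fun m hm => (e (m + 1)).1 fun y hy => by
      have hm' := (e m).2 hm
      rcases (lt_add_one_iff_le.1 hy).lt_or_eq with h | rfl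
      · exact hm' y h
      · intro hy
        obtain ⟨z, hz, hPz⟩ := hc y hy
        exact hm' z hz hPz) x
  obtain ⟨z, hz, hPz⟩ := hc x hx
  exact (e x).2 hall z hz hPz

/-- If `P` agrees below `x + 1` with a relation in `𝒟`, then the least number principle
for `𝒟` applies to `P`. -/
theorem LeastNumber.of_agree {𝒟 : RelClass S} (hl : LeastNumber 𝒟) {P Q : S.M → Prop}
    (hQ : 𝒟 (Unit × S.M) fun p => Q p.2) {x : S.M} (hx : P x)
    (hPQ : ∀ m, m < x + 1 → (P m ↔ Q m)) : ∃ x, P x ∧ ∀ y, y < x → ¬ P y := by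
  obtain ⟨y, hy, hmin⟩ := hl Q hQ ⟨x, (hPQ x (lt_succ_self_model x)).1 hx⟩
  have hyx : y ≤ x := by
    by_contra hc
    exact hmin x (not_le.1 hc) ((hPQ x (lt_succ_self_model x)).1 hx)
  exact ⟨y, (hPQ y (lt_add_one_iff_le.2 hyx)).2 hy, fun z hz hPz =>
    hmin z hz ((hPQ z (lt_add_one_iff_le.2 (hz.le.trans hyx))).1 hPz)⟩

theorem exists_agree {k : ℕ} (hk : PosClosed (Sig S k)) {𝒟 : RelClass S} (hc : Collection 𝒟)
    {P : S.M → Prop} {A : Unit × S.M → S.M → Prop}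
    (hA : Pi S k ((Unit × S.M) × S.M) fun p => A p.1 p.2) (e : ∀ x, P x ↔ ∃ z, A ((), x) z)
    {B : S.M → S.M → Prop}
    (hAB : 𝒟 ((Unit × S.M) × S.M) fun p => A ((), p.1.2) p.2 ∨ B p.1.2 p.2)
    (htot : ∀ y, (∃ z, A ((), y) z) ∨ ∃ z, B y z) (hB : ∀ y z, B y z → ¬ P y) (x : S.M) :
    ∃ Q : S.M → Prop, Pi S k (Unit × S.M) (fun p => Q p.2) ∧ ∀ m, m < x + 1 → (P m ↔ Q m) := by
  obtain ⟨s, hs⟩ := hc (fun y z => A ((), y) z ∨ B y z) hAB (x + 1) fun y _ => by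
    rcases htot y with ⟨z, hz⟩ | ⟨z, hz⟩
    · exact ⟨z, Or.inl hz⟩
    · exact ⟨z, Or.inr hz⟩
  refine ⟨fun m => ∃ z, z < s ∧ A ((), m) z, hk.pi.bex (.const s)
    (hk.pi.subst₁ hA (sub_unit.snoc poly1) poly0), fun m hm => ⟨fun h => ?_, ?_⟩⟩
  · obtain ⟨z, hz, h' | h'⟩ := hs m hm
    · exact ⟨z, hz, h'⟩
    · exact absurd h (hB m z h')
  · rintro ⟨z, -, hz⟩
    exact (e m).2 ⟨z, hz⟩

theorem leastNumber_sig_pi (hI : IndFor S Delta0) {k : ℕ}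
    (hc : ∀ j, j ≤ k → Collection (Pi S j)) :
    LeastNumber (Sig S k) ∧ LeastNumber (Pi S k) := by
  induction k with
  | zero =>
    have h := leastNumber_delta0 hI
    exact ⟨h, fun P hP => h P (RelClass.congr (𝒟 := DfnBy S Delta0) (closed_delta0.not hP)
      fun _ => not_not.symm)⟩
  | succ k ih =>
    obtain ⟨ihs, ihp⟩ := ih fun j hj => hc j (by omega)
    have hk : PosClosed (Sig S k) := posClosed_sig fun j hj => hc j (by omega)
    have hk1 : PosClosed (Sig S (k + 1)) := posClosed_sig fun j hj => hc j (by omega)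
    have key : ∀ (P : S.M → Prop), Sig S (k + 1) (Unit × S.M) (fun p => P p.2) → ∀ x,
        ∃ Q : S.M → Prop, Pi S k (Unit × S.M) (fun p => Q p.2) ∧
          ∀ m, m < x + 1 → (P m ↔ Q m) := by
      rintro P ⟨A, hA, e⟩ x
      have hA : Pi S k ((Unit × S.M) × S.M) fun p => A p.1 p.2 := hA
      have e' : ∀ x, P x ↔ ∃ z, A ((), x) z := fun x => e ((), x)
      refine exists_agree hk (hc (k + 1) le_rfl) hA e' (B := fun y _ => ∀ z, ¬ A ((), y) z)
        (hk1.pi.or hA.succ (Sig.pi_all ?_)) (fun y => ?_) (fun y _ h hP => ?_) x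
      · exact (hA.subst ((sub_unit.snoc poly2).snoc poly0) :
          Pi S k (((Unit × S.M) × S.M) × S.M) fun p => A ((), p.1.1.2) p.2)
      · by_cases h : ∃ z, A ((), y) z
        · exact Or.inl h
        · exact Or.inr ⟨0, not_exists.1 h⟩
      · exact not_exists.2 h ((e' y).1 hP)
    constructor
    · rintro P hP ⟨x, hx⟩
      obtain ⟨Q, hQ, hPQ⟩ := key P hP x
      exact ihp.of_agree hQ hx hPQ
    · rintro P hP ⟨x, hx⟩
      obtain ⟨Q, hQ, hPQ⟩ := key (fun x => ¬ P x) hP x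
      exact ihs.of_agree (Q := fun x => ¬ Q x) hQ hx fun m hm => by
        rw [← hPQ m hm, not_not]

theorem leastNumber_delta (hI : IndFor S Delta0) {k : ℕ}
    (hc : ∀ j, j ≤ k → Collection (Pi S j)) : LeastNumber (Delta S (k + 1)) := by
  rintro P ⟨⟨A, hA, e⟩, ⟨B, hB, e'⟩⟩ ⟨x, hx⟩
  have hk : PosClosed (Sig S k) := posClosed_sig fun j hj => hc j (by omega)
  have hA : Pi S k ((Unit × S.M) × S.M) fun p => A p.1 p.2 := hA
  have hB : Pi S k ((Unit × S.M) × S.M) fun p => B p.1 p.2 := hB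
  have eA : ∀ x, P x ↔ ∃ z, A ((), x) z := fun x => e ((), x)
  have eB : ∀ x, ¬ P x ↔ ∃ z, B ((), x) z := fun x => e' ((), x)
  obtain ⟨Q, hQ, hPQ⟩ := exists_agree hk (hc k le_rfl) hA eA (B := fun y z => B ((), y) z)
    (hk.pi.or hA hB) (fun y => by rw [← eA, ← eB]; exact em _)
    (fun y z h => (eB y).2 ⟨z, h⟩) x
  exact (leastNumber_sig_pi hI hc).2.of_agree hQ hx hPQ

/-! ## Schemes for formulas and for relations -/

theorem CollFor.collection {Γ : Fml → Prop} (hΓ : Stable Γ) (h : CollFor S Γ) :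
    Collection (DfnBy S Γ) := by
  intro R hR a ha
  obtain ⟨φ, hφ, v, e⟩ := Dfn.exists_formula₂ hΓ hR
  simp only [e] at ha ⊢
  exact h φ hφ v 1 0 one_ne_zero a ha

theorem WRFor.weakRegularity {Γ : Fml → Prop} (hΓ : Stable Γ) (h : WRFor S Γ) :
    WeakRegularity (DfnBy S Γ) := by
  intro R hR a ha
  obtain ⟨φ, hφ, v, e⟩ := Dfn.exists_formula₂ hΓ hR
  simp only [e] at ha ⊢
  exact h φ hφ v 1 0 one_ne_zero a ha

theorem poly_upd_upd (v : ℕ → S.M) (x y i : ℕ) :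
    Poly fun p : (Unit × S.M) × S.M => upd (upd v x p.1.2) y p.2 i :=
  poly_upd (τ := fun i (p : (Unit × S.M) × S.M) => upd v x p.1.2 i)
    (fun i => poly_upd (τ := fun i _ => v i) (fun i => .const (v i)) poly1 x i) poly0 y i

theorem Collection.collFor {Γ : Fml → Prop} {𝒟 : RelClass S} (hc : Collection 𝒟)
    (h : ∀ φ, Γ φ → ∀ τ : ℕ → (Unit × S.M) × S.M → S.M, (∀ i, Poly (τ i)) →
      𝒟 _ fun c => Sat0 S (fun i => τ i c) φ) : CollFor S Γ :=
  fun φ hφ v x y _ a ha => hc (fun m k => Sat0 S (upd (upd v x m) y k) φ)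
    (h φ hφ (fun i p => upd (upd v x p.1.2) y p.2 i) fun i => poly_upd_upd v x y i) a ha

theorem WeakRegularity.wRFor {Γ : Fml → Prop} {𝒟 : RelClass S} (hw : WeakRegularity 𝒟)
    (h : ∀ φ, Γ φ → ∀ τ : ℕ → (Unit × S.M) × S.M → S.M, (∀ i, Poly (τ i)) →
      𝒟 _ fun c => Sat0 S (fun i => τ i c) φ) : WRFor S Γ :=
  fun φ hφ v x y _ a ha => hw (fun m k => Sat0 S (upd (upd v x m) y k) φ)
    (h φ hφ (fun i p => upd (upd v x p.1.2) y p.2 i) fun i => poly_upd_upd v x y i) a ha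

theorem Collection.mono {𝒟 𝒟' : RelClass S} (h : Collection 𝒟)
    (hle : ∀ {C : Type} [Ctx S C] {R : C → Prop}, 𝒟' C R → 𝒟 C R) : Collection 𝒟' :=
  fun R hR => h R (hle hR)

theorem Sig.mono {j k : ℕ} (hjk : j ≤ k) {C : Type} [Ctx S C] {R : C → Prop}
    (h : Sig S j C R) : Sig S k C R := by
  induction hjk with
  | refl => exact h
  | step _ ih => exact ih.succ

theorem Pi.mono {j k : ℕ} (hjk : j ≤ k) {C : Type} [Ctx S C] {R : C → Prop}
    (h : Pi S j C R) : Pi S k C R :=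
  Sig.mono hjk h

/-! ## Weak regularity implies collection -/

theorem WeakRegularity.collection {𝒟 𝒟' : RelClass S} (hw : WeakRegularity 𝒟)
    (h : ∀ R : S.M → S.M → Prop, 𝒟' ((Unit × S.M) × S.M) (fun p => R p.1.2 p.2) →
      𝒟 ((Unit × S.M) × S.M) fun p => ∀ z, z < p.1.2 → ¬ R p.2 z) : Collection 𝒟' := by
  intro R hR a ha
  by_contra hc
  push Not at hc
  obtain ⟨y, hy, hcof⟩ := hw (fun x y => ∀ z, z < x → ¬ R y z) (h R hR) a hc
  obtain ⟨z, hz⟩ := ha y hy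
  obtain ⟨x, hx, hxy⟩ := hcof z
  exact hxy z hx hz

theorem Closed.collection {𝒟 : RelClass S} (h𝒟 : Closed 𝒟) (hw : WeakRegularity 𝒟) :
    Collection 𝒟 :=
  hw.collection fun _ hR => h𝒟.ball poly1 (h𝒟.not (h𝒟.rel₂ hR poly1 poly0))

theorem collection_pi_succ (hI : IndFor S Delta0) {n : ℕ} {𝒟 : RelClass S} (h𝒟 : Closed 𝒟)
    (hle : ∀ {C : Type} [Ctx S C] {R : C → Prop}, Pi S n C R → 𝒟 C R)
    (hge : ∀ {C : Type} [Ctx S C] {R : C → Prop}, 𝒟 C R → Delta S (n + 1) C R)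
    (hc : ∀ j, j ≤ n → Collection (Pi S j)) (hw : WeakRegularity 𝒟) :
    Collection (Pi S (n + 1)) := by
  rintro R ⟨T, hT, e⟩ a ha
  have hT : 𝒟 (((Unit × S.M) × S.M) × S.M) fun p => T p.1 p.2 := hle hT
  have e' : ∀ y b, ¬ R y b ↔ ∃ z, T (((), y), b) z := fun y b => e (((), y), b)
  by_contra hunb
  push Not at hunb
  have hapos : 0 < a := by
    obtain ⟨y, hy, -⟩ := hunb 0
    exact lt_of_le_of_lt (zero_le_model y) hy
  obtain ⟨A, hAdef⟩ : ∃ A : S.M → S.M → S.M → Prop, ∀ s u y,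
      A s u y ↔ ∀ b, b < u → ∃ z, z < s ∧ T (((), y), b) z := ⟨_, fun _ _ _ => Iff.rfl⟩
  have hA : 𝒟 (((Unit × S.M) × S.M) × S.M) fun p => A p.1.1.2 p.1.2 p.2 := by
    simp only [hAdef]
    exact h𝒟.ball poly1 (h𝒟.bex poly3
      (h𝒟.subst₁ hT ((sub_unit.snoc poly2).snoc poly1) poly0))
  have hU : 𝒟 ((Unit × S.M) × S.M) fun p => ∃ y, y < a ∧ A p.1.2 p.2 y :=
    h𝒟.bex (.const a) (h𝒟.rel₃ hA poly2 poly1 poly0)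
  have hmax : 𝒟 ((Unit × S.M) × S.M) fun p => ∀ u', u' < p.1.2 + 1 → p.2 < u' →
      ¬ ∃ y, y < a ∧ A p.1.2 u' y :=
    h𝒟.ball (poly1.add (.const 1)) (h𝒟.imp (h𝒟.lt poly1 poly0)
      (h𝒟.not (h𝒟.rel₂ (R := fun s u => ∃ y, y < a ∧ A s u y) hU poly2 poly0)))
  have hmono : ∀ {s s' u y}, s ≤ s' → A s u y → A s' u y := by
    intro s s' u y hs h
    rw [hAdef] at h ⊢
    intro b hb
    obtain ⟨z, hz, hTz⟩ := h b hb
    exact ⟨z, lt_of_lt_of_le hz hs, hTz⟩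
  obtain ⟨y, hy, hcof⟩ := hw (fun s y => ∃ u, u < s + 1 ∧ (A s u y ∧
      ∀ u', u' < s + 1 → u < u' → ¬ ∃ y, y < a ∧ A s u' y))
    (h𝒟.bex (poly1.add (.const 1)) (h𝒟.and (h𝒟.rel₃ hA poly2 poly0 poly1)
      (h𝒟.rel₂ (R := fun s u => ∀ u', u' < s + 1 → u < u' → ¬ ∃ y, y < a ∧ A s u' y)
        hmax poly2 poly0))) a (by
    intro s
    obtain ⟨w, hw, hmin⟩ := leastNumber_delta hI hc
      (fun u => ∀ u', u' < s + 1 → u < u' → ¬ ∃ y, y < a ∧ A s u' y)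
      (hge (h𝒟.rel₂ (R := fun s u => ∀ u', u' < s + 1 → u < u' → ¬ ∃ y, y < a ∧ A s u' y)
        hmax (.const s) poly0))
      ⟨s, fun u' hu' hsu => absurd (lt_add_one_iff_le.1 hu') (not_le.2 hsu)⟩
    have hws : w < s + 1 ∧ ∃ y, y < a ∧ A s w y := by
      obtain rfl | ⟨w', rfl⟩ := eq_zero_or_succ w
      · exact ⟨lt_add_one_iff_le.2 (zero_le_model s), 0, hapos, (hAdef _ _ _).2 fun b hb =>
          absurd hb (not_lt.2 (zero_le_model b))⟩
      · have h1 := hmin w' (lt_succ_self_model w')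
        push Not at h1
        obtain ⟨u', hu', hwu, y, hy, hAy⟩ := h1
        obtain rfl : u' = w' + 1 := by
          rcases lt_trichotomy u' (w' + 1) with h | h | h
          · exact absurd hwu (not_lt.2 (lt_add_one_iff_le.1 h))
          · exact h
          · exact absurd ⟨y, hy, hAy⟩ (hw u' hu' h)
        exact ⟨hu', y, hy, hAy⟩
    obtain ⟨hws, y, hy, hAy⟩ := hws
    exact ⟨y, hy, w, hws, hAy, hw⟩)
  obtain ⟨b, hb⟩ := ha y hy
  refine (e' y b).2 ?_ hb
  obtain ⟨y₀, hy₀, hR₀⟩ := hunb (b + 1)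
  obtain ⟨T', hT'⟩ : ∃ T' : Pi S n (((Unit × S.M) × S.M) × S.M) fun p => T p.1 p.2, True :=
    ⟨‹_›, trivial⟩
  obtain ⟨s₀, hs₀⟩ := hc n le_rfl (fun b z => T (((), y₀), b) z)
    (T'.subst (((sub_unit.snoc (.const y₀)).snoc poly1).snoc poly0)) (b + 1)
    fun b' hb' => (e' y₀ b').1 (hR₀ b' hb')
  have hA₀ : A s₀ (b + 1) y₀ := (hAdef _ _ _).2 hs₀
  obtain ⟨s, hs, u, hu, hAu, humax⟩ := hcof (max s₀ (b + 1))
  have hbu : b + 1 ≤ u := by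
    by_contra hc
    exact humax (b + 1) (lt_add_one_iff_le.2 ((le_max_right _ _).trans hs.le)) (not_le.1 hc)
      ⟨y₀, hy₀, hmono ((le_max_left _ _).trans hs.le) hA₀⟩
  obtain ⟨z, -, hz⟩ := (hAdef _ _ _).1 hAu b (lt_of_lt_of_le (lt_succ_self_model b) hbu)
  exact ⟨z, hz⟩

theorem WRFor.collFor_isSigma {n : ℕ} (hI : IndFor S Delta0) (hw : WRFor S (Sigma0Sigma n)) :
    CollFor S (IsSigma (n + 2)) := by
  have hG : Closed (DfnBy S (Sigma0Sigma n)) := closed_sigma0Sigma n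
  have hw' := hw.weakRegularity (stable_sigma0Sigma n)
  have hle : ∀ {C : Type} [Ctx S C] {R : C → Prop}, Pi S n C R →
      DfnBy S (Sigma0Sigma n) C R := by
    intro C _ R h
    exact RelClass.congr (𝒟 := DfnBy S (Sigma0Sigma n))
      (hG.not (Dfn.mono (fun _ => .ofSigma) (Sig.dfn h))) fun _ => not_not.symm
  have hc : ∀ j, j ≤ n → Collection (Pi S j) := fun j hj =>
    (hG.collection hw').mono fun h => hle (h.mono hj)
  have hc1 : Collection (Pi S (n + 1)) := by
    refine collection_pi_succ hI hG hle ?_ hc hw'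
    rintro C _ R ⟨φ, hφ, τ, hτ, e⟩
    exact RelClass.congr (𝒟 := Delta S (n + 1)) (hφ.delta hc hτ) e
  have hc' : ∀ j, j < n + 2 → Collection (Pi S j) := by
    intro j hj
    rcases Nat.lt_succ_iff_lt_or_eq.1 hj with h | rfl
    · exact hc j (by omega)
    · exact hc1
  have hcl : ∀ j, j < n + 2 → PosClosed (Sig S j) :=
    fun j hj => posClosed_sig fun i hi => hc' i (by omega)
  exact (hc1.sig_succ (hcl (n + 1) (by omega))).collFor fun φ hφ τ hτ => hφ.sig hcl hτ

theorem collection_pi_of_weakRegularity_sig {n : ℕ} (hw : WeakRegularity (Sig S n)) :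
    ∀ j, j < n → Collection (Pi S j) := by
  intro j
  induction j using Nat.strong_induction_on with
  | _ j ih =>
    intro hj
    have hcl : PosClosed (Sig S j) := posClosed_sig fun i hi => ih i hi (by omega)
    exact hw.collection fun R hR => Sig.mono hj.le
      (hcl.ball (P := fun p z => ¬ R p.2 z) poly1
        (hcl.rel₂ (R := fun y z => ¬ R y z) hR poly1 poly0))

theorem WRFor.wRFor_sigma0Sigma {n : ℕ} (hw : WRFor S (SigmaOrPi (n + 1))) :
    WRFor S (Sigma0Sigma n) := by
  have hw' : WeakRegularity (Sig S (n + 1)) := by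
    intro R hR a ha
    obtain ⟨φ, hφ, v, e⟩ := Dfn.exists_formula₂ (stable_isSigma (n + 1)) hR.dfn
    have e' : ∀ x y, R x y ↔ Sat0 S (upd (upd v 1 x) 0 y) (.or φ (.lt .zero .zero)) := by
      intro x y
      rw [e x y]
      exact ⟨Or.inl, fun h => h.elim id fun h => absurd h (hS.out.lt_irrefl _)⟩
    simp only [e'] at ha ⊢
    exact hw _ ⟨φ, _, hφ, .delta0 (.lt _ _), rfl⟩ v 1 0 one_ne_zero a ha
  have hc := collection_pi_of_weakRegularity_sig hw'
  exact hw'.wRFor fun φ hφ τ hτ => (hφ.delta (fun j hj => hc j (by omega)) hτ).1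

end Principles

section Codes

variable {S : Str} [hS : Fact (PAminus S)]

/-! ## Coding bounded sets -/

theorem dvd_iff_bounded {p E : S.M} (hp : p ≠ 0) : p ∣ E ↔ ∃ w, w < E + 1 ∧ E = p * w := by
  refine ⟨fun ⟨w, hw⟩ => ⟨w, lt_add_one_iff_le.2 ?_, hw⟩, fun ⟨w, _, hw⟩ => ⟨w, hw⟩⟩
  obtain rfl | ⟨q, rfl⟩ := eq_zero_or_succ p
  · exact absurd rfl hp
  · rw [hw, add_mul, one_mul]
    exact le_add_self

theorem PosClosed.dvd {𝒟 : RelClass S} (h𝒟 : PosClosed 𝒟) {C : Type} [Ctx S C]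
    {f g : C → S.M} (hf : Poly f) (hg : Poly g) (hpos : ∀ c, f c ≠ 0) :
    𝒟 C fun c => f c ∣ g c := by
  have h : 𝒟 C fun c => ∃ w, w < g c + 1 ∧ g c = f c * w :=
    h𝒟.bex (hg.add (.const 1)) (h𝒟.eq hg.lift (hf.lift.mul poly0))
  exact RelClass.congr h fun c => dvd_iff_bounded (hpos c)

theorem exists_common_multiple {k : ℕ} (hΔ : Closed (Delta S (k + 2)))
    (hl : LeastNumber (Delta S (k + 2))) {f : S.M → S.M}
    (hf : ∀ {C : Type} [Ctx S C] {g : C → S.M}, Poly g → Poly fun c => f (g c))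
    (hpos : ∀ j, f j ≠ 0) (L : S.M) : ∃ Q, Q ≠ 0 ∧ ∀ j, j < L → f j ∣ Q := by
  have h0 : PosClosed (Pi S 0) := posClosed_sig_zero.pi
  have hdef : Delta S (k + 2) (Unit × S.M) fun p => ∃ Q, Q ≠ 0 ∧ ∀ j, j < p.2 → f j ∣ Q :=
    (Sig.mono (by omega) (Pi.sig_ex (h0.and
      (Sig.pi_not (posClosed_sig_zero.eq poly0 (.const 0)))
      (h0.ball poly1 (h0.dvd (hf poly0) poly1 fun c => hpos _)))) :
      Sig S (k + 1) (Unit × S.M) _).delta_succ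
  refine hΔ.induction hl (P := fun L => ∃ Q, Q ≠ 0 ∧ ∀ j, j < L → f j ∣ Q) hdef ⟨1, one_ne_zero, fun j hj => absurd hj (not_lt.2 (zero_le_model j))⟩
    (fun L ⟨Q, hQ, hd⟩ => ⟨Q * f L, mul_ne_zero hQ (hpos L), fun j hj => ?_⟩) L
  rcases (lt_add_one_iff_le.1 hj).lt_or_eq with h | rfl
  · exact (hd j h).mul_right _
  · exact dvd_mul_left _ _

/-- `j` belongs to the set coded by `E` relative to the modulus parameter `m`. -/
def Coded (m E j : S.M) : Prop := 1 + (j + 1) * m ∣ E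

theorem one_add_ne_zero_model (a : S.M) : 1 + a ≠ 0 :=
  (lt_of_lt_of_le one_pos le_self_add).ne'

theorem PosClosed.coded {𝒟 : RelClass S} (h𝒟 : PosClosed 𝒟) {C : Type} [Ctx S C]
    {f g k : C → S.M} (hf : Poly f) (hg : Poly g) (hk : Poly k) :
    𝒟 C fun c => Coded (f c) (g c) (k c) :=
  h𝒟.dvd (.add (.const 1) (.mul (.add hk (.const 1)) hf)) hg fun _ => one_add_ne_zero_model _

theorem exists_code {k : ℕ} (hΔ : Closed (Delta S (k + 2)))
    (hl : LeastNumber (Delta S (k + 2))) (L : S.M) :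
    ∃ m Q : S.M, ∀ R : S.M → Prop, Delta S (k + 2) (Unit × S.M) (fun p => R p.2) →
      ∃ E, E < Q + 1 ∧ ∀ i, i < L → (Coded m E i ↔ R i) := by
  obtain ⟨m, hm0, hm⟩ := exists_common_multiple hΔ hl (f := fun j => j + 1)
    (fun hg => hg.add (.const 1)) (fun j => by rw [add_comm]; exact one_add_ne_zero_model j) L
  obtain ⟨Q, hQ0, hQ⟩ := exists_common_multiple hΔ hl (f := fun j => 1 + (j + 1) * m)
    (fun hg => .add (.const 1) (.mul (.add hg (.const 1)) (.const m)))
    (fun j => one_add_ne_zero_model _) L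
  refine ⟨m, Q, fun R hR => ?_⟩
  obtain ⟨E, ⟨hE0, hE⟩, hmin⟩ := hl (fun E => E ≠ 0 ∧ ∀ i, i < L → R i → Coded m E i)
    (hΔ.and (hΔ.not (hΔ.eq poly0 (.const 0))) (hΔ.ball (.const L)
      (hΔ.imp (hΔ.rel₁ hR poly0) (hΔ.coded (.const m) poly1 poly0))))
    ⟨Q, hQ0, fun i hi _ => hQ i hi⟩
  refine ⟨E, lt_add_one_iff_le.2 (not_lt.1 fun h => hmin Q h ⟨hQ0, fun i hi _ => hQ i hi⟩),
    fun i hi => ⟨fun ⟨w, hw⟩ => ?_, hE i hi⟩⟩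
  by_contra hRi
  have hw0 : w ≠ 0 := by
    rintro rfl
    exact hE0 (by rw [hw, mul_zero])
  refine hmin w ?_ ⟨hw0, fun j hj hRj => ?_⟩
  · have h : 0 < (i + 1) * m * w := by
      have hi1 : i + 1 ≠ 0 := by rw [add_comm]; exact one_add_ne_zero_model i
      exact pos_iff_ne_zero.2 (mul_ne_zero (mul_ne_zero hi1 hm0) hw0)
    rw [hw, add_mul, one_mul]
    exact lt_add_of_pos_right w h
  · have hj' : 1 + (j + 1) * m ∣ E := hE j hj hRj
    rw [hw] at hj'
    exact betaModulus_dvd hm hi hj (fun e => hRi (e ▸ hRj)) hj'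

/-! ## Collection implies weak regularity -/

/-- `y` is the remainder of `j` modulo `a`. -/
def IsRem (a j y : S.M) : Prop := ∃ q, q < j + 1 ∧ j = q * a + y

/-- Every `x` has a witness `y < a` for `φ` none of whose indices below `x`, in the
enumeration of `a` by remainders, satisfies `X`. -/
def Survives (φ : S.M → S.M → Prop) (a : S.M) (X : S.M → Prop) : Prop :=
  ∀ x, ∃ y, y < a ∧ (φ x y ∧ ∀ j, j < x → IsRem a j y → ¬ X j)

/-- `E` codes the first `L` steps of the greedy removal of indices. -/
def Correct (φ : S.M → S.M → Prop) (a m E L : S.M) : Prop :=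
  ∀ i, i < L → (Coded m E i ↔ Survives φ a fun j => j < i ∧ Coded m E j ∨ j = i)

theorem Survives.congr {φ : S.M → S.M → Prop} {a : S.M} {X Y : S.M → Prop}
    (h : ∀ j, X j ↔ Y j) : Survives φ a X ↔ Survives φ a Y := by
  obtain rfl : X = Y := funext fun j => propext (h j)
  rfl

theorem PosClosed.isRem {𝒟 : RelClass S} (h𝒟 : PosClosed 𝒟) {C : Type} [Ctx S C]
    (a : S.M) {f g : C → S.M} (hf : Poly f) (hg : Poly g) : 𝒟 C fun c => IsRem a (f c) (g c) :=
  h𝒟.bex (hf.add (.const 1)) (h𝒟.eq hf.lift (.add (.mul poly0 (.const a)) hg.lift))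

theorem Survives.pi {k : ℕ} (hk : PosClosed (Sig S k)) (hk1 : PosClosed (Sig S (k + 1)))
    {φ : S.M → S.M → Prop} (hφ : Pi S (k + 1) ((Unit × S.M) × S.M) fun p => φ p.1.2 p.2)
    (a : S.M) {C : Type} [Ctx S C] {X : C → S.M → Prop}
    (hX : DfnBy S Delta0 (C × S.M) fun p => X p.1 p.2) :
    Pi S (k + 1) C fun c => Survives φ a (X c) := by
  refine Pi.all hk (hk1.pi.bex (.const a) (hk1.pi.and (hk1.pi.rel₂ hφ poly1 poly0) ?_))
  have h : DfnBy S Delta0 (((C × S.M) × S.M) × S.M) fun p => IsRem a p.2 p.1.2 → ¬ X p.1.1.1 p.2 :=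
    closed_delta0.imp (closed_delta0.isRem a poly0 poly1)
      (closed_delta0.not (closed_delta0.subst₁ hX sub_fst.comp_fst.comp_fst poly0))
  exact hk1.pi.ball poly1 (hk1.pi.delta0 h)

section Greedy

variable {k : ℕ} (hk : PosClosed (Sig S k)) (hk1 : PosClosed (Sig S (k + 1)))
  (hΔ : Closed (Delta S (k + 2))) (hl : LeastNumber (Delta S (k + 2)))
  {φ : S.M → S.M → Prop} (hφ : Pi S (k + 1) ((Unit × S.M) × S.M) fun p => φ p.1.2 p.2) {a : S.M}

include hk hk1 hφ in
theorem survives_step_pi {C : Type} [Ctx S C] {f g i : C → S.M} (hf : Poly f) (hg : Poly g)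
    (hi : Poly i) : Pi S (k + 1) C fun c =>
      Survives φ a fun j => j < i c ∧ Coded (f c) (g c) j ∨ j = i c :=
  Survives.pi hk hk1 hφ a (closed_delta0.or (closed_delta0.and (closed_delta0.lt poly0 hi.lift)
    (closed_delta0.coded hf.lift hg.lift poly0)) (closed_delta0.eq poly0 hi.lift))

include hk hk1 hΔ hφ in
theorem Correct.delta {C : Type} [Ctx S C] {f g l : C → S.M} (hf : Poly f) (hg : Poly g)
    (h : Poly l) : Delta S (k + 2) C fun c => Correct φ a (f c) (g c) (l c) :=
  hΔ.ball h (hΔ.iff (hΔ.coded hf.lift hg.lift poly0)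
    (survives_step_pi hk hk1 hφ hf.lift hg.lift poly0).delta_succ)

include hk hk1 hΔ hl hφ in
theorem exists_correct (L : S.M) : ∃ m E, Correct φ a m E L := by
  obtain ⟨m, Q, hQ⟩ := exists_code hΔ hl L
  suffices h : ∀ i, i < L + 1 → ∃ E, E < Q + 1 ∧ Correct φ a m E i by
    obtain ⟨E, -, hE⟩ := h L (lt_succ_self_model L)
    exact ⟨m, E, hE⟩
  refine hΔ.induction hl (hΔ.imp (hΔ.lt poly0 (.const _)) (hΔ.bex (.const _)
    (Correct.delta hk hk1 hΔ hφ (.const m) poly0 poly1)))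
    (fun _ => ⟨0, lt_add_one_iff_le.2 (zero_le_model Q), fun j hj =>
      absurd hj (not_lt.2 (zero_le_model j))⟩) fun i ih hi => ?_
  have hiL : i < L := lt_of_lt_of_le (lt_succ_self_model i) (lt_add_one_iff_le.1 hi)
  obtain ⟨E, -, hE⟩ := ih (hiL.trans (lt_succ_self_model L))
  obtain ⟨E', hE'Q, hE'⟩ := hQ (fun j => j < i ∧ Coded m E j ∨
      j = i ∧ Survives φ a fun j' => j' < i ∧ Coded m E j' ∨ j' = i)
    (hΔ.or (hΔ.and (hΔ.lt poly0 (.const i)) (hΔ.coded (.const m) (.const E) poly0))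
      (hΔ.and (hΔ.eq poly0 (.const i))
        (survives_step_pi hk hk1 hφ (.const m) (.const E) (.const i)).delta_succ))
  have hlt : ∀ j, j < i → (Coded m E' j ↔ Coded m E j) := fun j hj => by
    rw [hE' j (hj.trans hiL)]
    simp [hj, hj.ne]
  refine ⟨E', hE'Q, fun j hj => ?_⟩
  have hagree : ∀ j', (j' < j ∧ Coded m E' j' ∨ j' = j) ↔ (j' < j ∧ Coded m E j' ∨ j' = j) :=
    fun j' => or_congr_left (and_congr_right fun h =>
      hlt j' (lt_of_lt_of_le h (lt_add_one_iff_le.1 hj)))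
  rw [Survives.congr hagree]
  rcases (lt_add_one_iff_le.1 hj).lt_or_eq with h | rfl
  · rw [hlt j h]
    exact hE j h
  · rw [hE' j hiL]
    simp

include hΔ hl in
theorem Correct.coherent {m E L m' E' L' : S.M} (h : Correct φ a m E L)
    (h' : Correct φ a m' E' L') {i : S.M} (hi : i < L) (hi' : i < L') :
    Coded m E i ↔ Coded m' E' i := by
  by_contra hne
  obtain ⟨j, ⟨hj, hj', hjne⟩, hmin⟩ := hl
    (fun j => j < L ∧ j < L' ∧ ¬ (Coded m E j ↔ Coded m' E' j))
    (hΔ.and (hΔ.lt poly0 (.const _)) (hΔ.and (hΔ.lt poly0 (.const _))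
      (hΔ.not (hΔ.iff (hΔ.coded (.const _) (.const _) poly0)
        (hΔ.coded (.const _) (.const _) poly0))))) ⟨i, hi, hi', hne⟩
  refine hjne ((h j hj).trans (Iff.trans (Survives.congr fun j' => ?_) (h' j hj').symm))
  refine or_congr_left (and_congr_right fun hlt => ?_)
  by_contra hc
  exact hmin j' hlt ⟨hlt.trans hj, hlt.trans hj', hc⟩

include hk hk1 hΔ hl hφ in
theorem Correct.survives (htot : ∀ x, ∃ y, y < a ∧ φ x y) {m E L : S.M}
    (h : Correct φ a m E L) : ∀ i, i < L + 1 → Survives φ a fun j => j < i ∧ Coded m E j := by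
  have hdef : Pi S (k + 1) (Unit × S.M) fun p => Survives φ a fun j => j < p.2 ∧ Coded m E j :=
    Survives.pi hk hk1 hφ a (closed_delta0.and (closed_delta0.lt poly0 poly1)
      (closed_delta0.coded (.const m) (.const E) poly0))
  refine hΔ.induction hl (hΔ.imp (hΔ.lt poly0 (.const _)) hdef.delta_succ)
    (fun _ x => ?_) fun i ih hi => ?_
  · obtain ⟨y, hy, hxy⟩ := htot x
    exact ⟨y, hy, hxy, fun j _ _ hj => not_lt.2 (zero_le_model j) hj.1⟩
  have hiL : i < L := lt_of_lt_of_le (lt_succ_self_model i) (lt_add_one_iff_le.1 hi)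
  by_cases hmem : Coded m E i
  · intro x
    obtain ⟨y, hy, hxy, hsur⟩ := (h i hiL).1 hmem x
    refine ⟨y, hy, hxy, fun j hjx hj hc => hsur j hjx hj ?_⟩
    exact (lt_add_one_iff_le.1 hc.1).lt_or_eq.imp (fun hlt => ⟨hlt, hc.2⟩) id
  · intro x
    obtain ⟨y, hy, hxy, hsur⟩ := ih (hiL.trans (lt_succ_self_model L)) x
    refine ⟨y, hy, hxy, fun j hjx hj hc => ?_⟩
    rcases (lt_add_one_iff_le.1 hc.1).lt_or_eq with hlt | rfl
    · exact hsur j hjx hj ⟨hlt, hc.2⟩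
    · exact hmem hc.2

end Greedy

theorem weakRegularity_pi (hI : IndFor S Delta0) {k : ℕ}
    (hc : ∀ j, j ≤ k + 1 → Collection (Pi S j)) :
    WeakRegularity (Pi S (k + 1)) := by
  intro φ hφ a htot
  have hp : ∀ j, j ≤ k + 2 → PosClosed (Sig S j) := fun j hj =>
    posClosed_sig fun i hi => hc i (by omega)
  have hk := hp k (by omega)
  have hk1 := hp (k + 1) (by omega)
  have hk2 := hp (k + 2) le_rfl
  have hΔ : Closed (Delta S (k + 2)) := hk2.delta
  have hl : LeastNumber (Delta S (k + 2)) := leastNumber_delta hI hc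
  by_contra hcof
  have hremoved : ∀ y, y < a → ∃ i, IsRem a i y ∧
      ∃ m E, Correct φ a m E (i + 1) ∧ Coded m E i := by
    intro y hy
    by_contra hnot
    push Not at hnot
    refine hcof ⟨y, hy, fun b => ?_⟩
    have hapos : 0 < a := lt_of_le_of_lt (zero_le_model y) hy
    obtain ⟨r, rfl⟩ : ∃ r, a = r + 1 := (eq_zero_or_succ a).resolve_left hapos.ne'
    have hb : b ≤ b * (r + 1) + y := by
      rw [mul_add, mul_one, add_assoc, add_comm]
      exact le_add_right le_self_add
    have hrem : IsRem (r + 1) (b * (r + 1) + y) y := ⟨b, lt_add_one_iff_le.2 hb, rfl⟩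
    obtain ⟨m, E, hE⟩ := exists_correct hk hk1 hΔ hl hφ (a := r + 1) (b * (r + 1) + y + 1)
    have hstep := mt (hE _ (lt_succ_self_model _)).2 (hnot _ hrem m E hE)
    unfold Survives at hstep
    push Not at hstep
    obtain ⟨x, hx⟩ := hstep
    obtain ⟨y', hy', hxy, hsur⟩ := hE.survives hk hk1 hΔ hl hφ htot (b * (r + 1) + y)
      ((lt_succ_self_model _).trans (lt_succ_self_model _)) x
    obtain ⟨j, hjx, hj, h | rfl⟩ := hx y' hy' hxy
    · exact absurd h (hsur j hjx hj)
    · obtain ⟨q, -, hq⟩ := hj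
      obtain rfl := remainder_unique hy hy' hq
      exact ⟨x, lt_of_le_of_lt hb hjx, hxy⟩
  obtain ⟨I, hIrem⟩ := (Collection.sig_succ hk1 (hc (k + 1) le_rfl))
    (fun y i => IsRem a i y ∧ ∃ m E, Correct φ a m E (i + 1) ∧ Coded m E i)
    (hk2.and (hk2.isRem a poly0 poly1) (Sig.ex hk1 (Sig.ex hk1 (hk2.and
      (Correct.delta hk hk1 hΔ hφ poly1 poly0 (poly2.add (.const 1))).1
      (hk2.coded poly1 poly0 poly2))))) a hremoved
  obtain ⟨m, E, hE⟩ := exists_correct hk hk1 hΔ hl hφ (a := a) I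
  obtain ⟨y, hy, -, hsur⟩ := hE.survives hk hk1 hΔ hl hφ htot I (lt_succ_self_model I) I
  obtain ⟨i, hi, hrem, m', E', hE', hmem⟩ := hIrem y hy
  exact hsur i hi hrem ⟨hi, (hE.coherent hΔ hl hE' hi (lt_succ_self_model i)).2 hmem⟩

theorem weakRegularity_sig_or_pi {k : ℕ} (hk : PosClosed (Sig S k)) (hc : Collection (Pi S k))
    (hc1 : Collection (Pi S (k + 1))) (hw : WeakRegularity (Pi S (k + 1)))
    {ψ χ : S.M → S.M → Prop}
    (hψ : Sig S (k + 1) ((Unit × S.M) × S.M) fun p => ψ p.1.2 p.2)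
    (hχ : Pi S (k + 1) ((Unit × S.M) × S.M) fun p => χ p.1.2 p.2) (a : S.M)
    (htot : ∀ x, ∃ y, y < a ∧ (ψ x y ∨ χ x y)) :
    ∃ y, y < a ∧ ∀ b, ∃ x, b < x ∧ (ψ x y ∨ χ x y) := by
  have hk1 : PosClosed (Sig S (k + 1)) := hk.sig_succ hc
  by_contra! hcof
  obtain ⟨b, hb⟩ := hc1 (fun y b => ∀ x, b < x → ¬ ψ x y)
    (Pi.all hk (RelClass.congr (hk1.pi.or
      (hk1.pi.delta0 (closed_delta0.not (closed_delta0.lt poly1 poly0)))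
      (hk1.rel₂ hψ poly0 poly2).pi_not) fun _ => imp_iff_not_or)) a fun y hy => by
    obtain ⟨b, hb⟩ := hcof y hy
    exact ⟨b, fun x hx => (hb x hx).1⟩
  obtain ⟨y, hy, hy'⟩ := hw (fun x y => χ (b + x) y)
    (hk1.pi.rel₂ hχ (.add (.const b) poly1) poly0) a fun x => by
    obtain ⟨y, hy, h | h⟩ := htot (b + x)
    · obtain ⟨z, hz, hzy⟩ := hb y hy
      exact absurd h (hzy _ (lt_of_lt_of_le hz le_self_add))
    · exact ⟨y, hy, h⟩
  obtain ⟨c, hcy⟩ := hcof y hy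
  obtain ⟨x, hx, hxy⟩ := hy' c
  exact (hcy _ (lt_of_lt_of_le hx le_add_self)).2 hxy

theorem CollFor.wRFor_sigmaOrPi (hI : IndFor S Delta0) {n : ℕ}
    (h : CollFor S (IsSigma (n + 2))) : WRFor S (SigmaOrPi (n + 1)) := by
  have hs : Collection (Sig S (n + 2)) := (h.collection (stable_isSigma _)).mono Sig.dfn
  have hc : ∀ j, j ≤ n + 1 → Collection (Pi S j) := fun j hj =>
    hs.mono fun hR => Sig.mono (by omega) hR.sig_succ
  have hp : ∀ j, j < n + 1 → PosClosed (Sig S j) := fun j hj =>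
    posClosed_sig fun i hi => hc i (by omega)
  rintro _ ⟨ψ, χ, hψ, hχ, rfl⟩ v x y _ a ha
  exact weakRegularity_sig_or_pi (hp n (by omega)) (hc n (by omega)) (hc (n + 1) le_rfl)
    (weakRegularity_pi hI hc)
    (ψ := fun m k => Sat0 S (upd (upd v x m) y k) ψ)
    (χ := fun m k => Sat0 S (upd (upd v x m) y k) χ) (hψ.sig hp fun i => poly_upd_upd v x y i)
    (hχ.pi hp fun i => poly_upd_upd v x y i) a ha

end Codes

/-- Theorem `thm:rpiequivalence`.
For each `n ∈ ℕ`, the theories `WRΣ₀(Σₙ)`, `WR(Σₙ₊₁ ∨ Πₙ₊₁)` and `BΣₙ₊₂`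
are pairwise equivalent: they have the same models (over `IΔ₀`, which is
included in each of `WRΓ` and `BΣₙ₊₂`). -/
theorem statement_16 (n : ℕ) (S : Str) :
    ((IDelta0 S ∧ WRFor S (Sigma0Sigma n)) ↔
      (IDelta0 S ∧ WRFor S (SigmaOrPi (n + 1)))) ∧
    ((IDelta0 S ∧ WRFor S (SigmaOrPi (n + 1))) ↔ BSigma S (n + 2)) := by
  have hT13 : IDelta0 S ∧ WRFor S (Sigma0Sigma n) → BSigma S (n + 2) := fun ⟨⟨hP, hI⟩, hw⟩ =>
    haveI : Fact (PAminus S) := ⟨hP⟩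
    ⟨⟨hP, hI⟩, hw.collFor_isSigma hI⟩
  have hT32 : BSigma S (n + 2) → IDelta0 S ∧ WRFor S (SigmaOrPi (n + 1)) := fun ⟨⟨hP, hI⟩, hc⟩ =>
    haveI : Fact (PAminus S) := ⟨hP⟩
    ⟨⟨hP, hI⟩, hc.wRFor_sigmaOrPi hI⟩
  have hT21 : IDelta0 S ∧ WRFor S (SigmaOrPi (n + 1)) → IDelta0 S ∧ WRFor S (Sigma0Sigma n) :=
    fun ⟨⟨hP, hI⟩, hw⟩ =>
    haveI : Fact (PAminus S) := ⟨hP⟩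
    ⟨⟨hP, hI⟩, hw.wRFor_sigma0Sigma⟩
  exact ⟨⟨fun h => hT32 (hT13 h), hT21⟩, fun h => hT13 (hT21 h), hT32⟩

end PaperArith
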